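/- arXiv:1310.6008 — 12 statements merged into one kernel-verified Lean document; each statement's English description precedes it below -/
import Mathlib

section
/- Suppose q ≥ 2 and n ≥ 2, and that it is not the case that both q = 2 and n = 2. Then there exists a set X of instructions on A^n with |X| = n that generates the full symmetric group Sym(A^n). -/
/-- An *instruction* on `A^n` is a permutation of `Fin n → A` which changes
at most one coordinate (the updated register `j`). -/
def IsInstruction {n : ℕ} {A : Type*} (g : Equiv.Perm (Fin n → A)) : Prop :=
  ∃ j : Fin n, ∀ (x : Fin n → A) (i : Fin n), i ≠ j → g x i = x i

open Equiv
open Function (Injective update update_self update_of_ne update_idem update_eq_self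
  update_eq_self_iff eq_update_iff)

/-- If a group contains the transposition of `a` and `b`, is generated by permutations each of which
maps `a` or `b` into `{a, b}`, and acts transitively, then it is the full symmetric group. -/
theorem closure_eq_top_of_swap_mem {α : Type*} [Finite α] [DecidableEq α]
    (X : Set (Perm α)) (a b : α) (hab : swap a b ∈ Subgroup.closure X)
    (hX : ∀ g ∈ X, g a = a ∨ g a = b ∨ g b = b)
    (hS : ∀ S : Set α, a ∈ S → (∀ g ∈ X, ∀ x ∈ S, g x ∈ S) → ∀ x, x ∈ S) :
    Subgroup.closure X = ⊤ := by
  set G := Subgroup.closure X with hG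
  have trans {x y z : α} (hxy : swap x y ∈ G) (hyz : swap y z ∈ G) : swap x z ∈ G := by
    rcases eq_or_ne x y with rfl | hne
    · exact hyz
    rcases eq_or_ne x z with rfl | hne'
    · rw [swap_self]; exact G.one_mem
    rw [swap_comm x z, ← swap_mul_swap_mul_swap hne hne']
    exact G.mul_mem (G.mul_mem hyz hxy) hyz
  have symm {x y : α} (hxy : swap x y ∈ G) : swap y x ∈ G := by rwa [swap_comm]
  have conj {g : Perm α} (hg : g ∈ X) {x y : α} (hxy : swap x y ∈ G) :
      swap (g x) (g y) ∈ G := by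
    have hgG : g ∈ G := Subgroup.subset_closure hg
    rw [swap_apply_apply]
    exact G.mul_mem (G.mul_mem hgG hxy) (G.inv_mem hgG)
  have key : ∀ x, swap a x ∈ G := by
    refine hS {x | swap a x ∈ G} ?_ fun g hg x hx => ?_
    · rw [Set.mem_ofPred_eq, swap_self]; exact G.one_mem
    · have hga : swap a (g a) ∈ G := by
        rcases hX g hg with h | h | h
        · rw [h, swap_self]; exact G.one_mem
        · rwa [h]
        · have := conj hg (symm hab)
          rw [h] at this
          exact trans hab this
      exact trans hga (conj hg hx)
  rw [eq_top_iff, ← Perm.closure_isSwap, Subgroup.closure_le]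
  rintro _ ⟨x, y, -, rfl⟩
  exact trans (symm (key x)) (key y)

/-- The permutation of `ι → A` applying `σ x` to the coordinate `j` of `x`, where `σ x` does not
depend on that coordinate. -/
def updatePerm {ι A : Type*} [DecidableEq ι] (j : ι) (σ : (ι → A) → Perm A)
    (hσ : ∀ x c, σ (update x j c) = σ x) : Perm (ι → A) where
  toFun x := update x j (σ x (x j))
  invFun x := update x j ((σ x)⁻¹ (x j))
  left_inv x := by simp [hσ]
  right_inv x := by simp [hσ]

theorem updatePerm_apply {ι A : Type*} [DecidableEq ι] (j : ι) (σ : (ι → A) → Perm A)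
    (hσ : ∀ x c, σ (update x j c) = σ x) (x : ι → A) :
    updatePerm j σ hσ x = update x j (σ x (x j)) := rfl

theorem updatePerm_pow_apply {ι A : Type*} [DecidableEq ι] (j : ι) (σ : (ι → A) → Perm A)
    (hσ : ∀ x c, σ (update x j c) = σ x) (k : ℕ) (x : ι → A) :
    (updatePerm j σ hσ ^ k) x = update x j ((σ x ^ k) (x j)) := by
  induction k with
  | zero => simp
  | succ k ih => simp [pow_succ', ih, updatePerm_apply, hσ]

/-- A set of functions closed under arbitrary changes of the coordinates in `J` contains every
function agreeing with one of its members outside `J`. -/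
theorem mem_of_forall_update_mem {ι A : Type*} [Fintype ι] [DecidableEq ι]
    {S : Set (ι → A)} {J : Set ι} (hS : ∀ x ∈ S, ∀ j ∈ J, ∀ c, update x j c ∈ S)
    {x y : ι → A} (hx : x ∈ S) (hxy : ∀ i ∉ J, x i = y i) : y ∈ S := by
  have key : ∀ s : Finset ι, s.piecewise y x ∈ S := by
    intro s
    induction s using Finset.induction_on with
    | empty => simpa using hx
    | insert i s _ ih =>
      rw [Finset.piecewise_insert]
      by_cases hi : i ∈ J
      · exact hS _ ih i hi _
      · rw [← hxy i hi, update_eq_self_iff.2]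
        · exact ih
        · by_cases his : i ∈ s
          · rw [Finset.piecewise_eq_of_mem _ _ _ his, hxy i hi]
          · rw [Finset.piecewise_eq_of_notMem _ _ _ his]
  simpa using key Finset.univ

theorem update_mem_of_forall_pow {ι A : Type*} [DecidableEq ι] {S : Set (ι → A)} {j : ι}
    {τ : Perm A} (hτ : ∀ c d, ∃ k : ℕ, (τ ^ k) c = d)
    (hS : ∀ x ∈ S, update x j (τ (x j)) ∈ S) {x : ι → A} (hx : x ∈ S) (c : A) :
    update x j c ∈ S := by
  have key : ∀ k : ℕ, update x j ((τ ^ k) (x j)) ∈ S := by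
    intro k
    induction k with
    | zero => simpa using hx
    | succ k ih => simpa [pow_succ'] using hS _ ih
  obtain ⟨k, rfl⟩ := hτ (x j) c
  exact key k

/-- A family of instructions, one for each register, generating the symmetric group consists of
distinct instructions. -/
theorem exists_finset_of_closure_range_eq_top {n : ℕ} {A : Type*} [Fintype A] [DecidableEq A]
    [Nontrivial A] (g : Fin n → Perm (Fin n → A))
    (hg : ∀ j x i, i ≠ j → g j x i = x i) (htop : Subgroup.closure (Set.range g) = ⊤) :
    ∃ X : Finset (Perm (Fin n → A)),
      X.card = n ∧ (∀ g ∈ X, IsInstruction g) ∧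
      Subgroup.closure (X : Set (Perm (Fin n → A))) = ⊤ := by
  have hinj : Injective g := by
    intro i j hij
    by_contra hne
    obtain ⟨a, b, hab⟩ := exists_pair_ne A
    have hfix : ∀ k x, g k x j = x j := by
      intro k x
      by_cases hk : j = k
      · subst hk
        rw [← hij, hg i x j (Ne.symm hne)]
      · exact hg k x j hk
    have hall : ∀ p ∈ Subgroup.closure (Set.range g), ∀ x, p x j = x j := by
      intro p hp
      induction hp using Subgroup.closure_induction with
      | mem p hp => obtain ⟨k, rfl⟩ := hp; exact hfix k
      | one => intro x; rfl
      | mul p r _ _ hp hr => intro x; rw [Perm.mul_apply, hp, hr]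
      | inv p _ hp =>
        intro x
        simpa using (hp (p⁻¹ x)).symm
    have := hall (swap (fun _ => a) (fun _ => b)) (htop ▸ Subgroup.mem_top _) fun _ => a
    rw [swap_apply_left] at this
    exact hab this.symm
  refine ⟨Finset.univ.image g, ?_, ?_, ?_⟩
  · rw [Finset.card_image_of_injective _ hinj, Finset.card_univ, Fintype.card_fin]
  · intro p hp
    obtain ⟨j, -, rfl⟩ := Finset.mem_image.1 hp
    exact ⟨j, hg j⟩
  · simpa using htop

theorem updatePerm_pow_eq_swap {ι A : Type*} [DecidableEq ι] [DecidableEq A]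
    [DecidableEq (ι → A)] (j : ι) (a b : A)
    (σ : (ι → A) → Perm A) (hσ : ∀ x c, σ (update x j c) = σ x) (k : ℕ)
    (h₁ : σ (fun _ => a) ^ k = swap a b)
    (h₂ : ∀ x, (∃ i, i ≠ j ∧ x i ≠ a) → σ x ^ k = 1) :
    updatePerm j σ hσ ^ k = swap (fun _ => a) (update (fun _ => a) j b) := by
  ext1 x
  rw [updatePerm_pow_apply]
  by_cases hx : ∃ i, i ≠ j ∧ x i ≠ a
  · rw [h₂ x hx, swap_apply_of_ne_of_ne]
    · simp
    · rintro rfl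
      simp at hx
    · rintro rfl
      obtain ⟨i, hi, hx⟩ := hx
      simp [hi] at hx
  · push Not at hx
    obtain ⟨c, rfl⟩ : ∃ c, x = update (fun _ => a) j c := by
      refine ⟨x j, ?_⟩
      rw [eq_update_iff]
      exact ⟨rfl, hx⟩
    rw [hσ, h₁, update_self, update_idem]
    rcases eq_or_ne c a with rfl | hca
    · rw [swap_apply_left, update_eq_self_iff.2 rfl, swap_apply_left]
    rcases eq_or_ne c b with rfl | hcb
    · rw [swap_apply_right, swap_apply_right, update_eq_self_iff.2 rfl]
    · rw [swap_apply_of_ne_of_ne hca hcb, swap_apply_of_ne_of_ne]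
      · exact fun h => hca (by simpa using congrFun h j)
      · exact fun h => hcb (by simpa using congrFun h j)

theorem exists_generating_instructions_of_two_lt_card {m : ℕ} {A : Type*} [Fintype A]
    [DecidableEq A] (hA : 2 < Fintype.card A) :
    ∃ g : Fin (m + 2) → Perm (Fin (m + 2) → A),
      (∀ j x i, i ≠ j → g j x i = x i) ∧ Subgroup.closure (Set.range g) = ⊤ := by
  obtain ⟨a, b, d, hab, had, hbd⟩ := Fintype.two_lt_card_iff.1 hA
  obtain ⟨τ, hτ'⟩ : ∃ τ : Perm A, ∀ c d, ∃ k : ℕ, (τ ^ k) c = d := by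
    obtain ⟨τ, hτ, -⟩ := (Finset.univ : Finset A).exists_cycleOn
    refine ⟨τ, fun c d => ?_⟩
    obtain ⟨k, -, hk⟩ := hτ.exists_pow_eq (Finset.mem_univ c) (Finset.mem_univ d)
    exact ⟨k, hk⟩
  let t : A → A := fun c => if c = a ∨ c = b then d else c
  have ht : ∀ c, t c ≠ a ∧ t c ≠ b := by
    intro c
    by_cases hc : c = a ∨ c = b
    · simp [t, hc, had.symm, hbd.symm]
    · simpa only [t, if_neg hc, not_or] using hc
  let σ : (Fin (m + 2) → A) → Perm A := fun x =>
    if ∀ i, i ≠ 0 → x i = a then swap a b else swap a b * swap b (t (x 1))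
  have hσ : ∀ x c, σ (update x 0 c) = σ x := by
    intro x c
    have : (∀ i, i ≠ 0 → update x 0 c i = a) ↔ ∀ i, i ≠ 0 → x i = a :=
      forall₂_congr fun i hi => by rw [update_of_ne hi]
    simp only [σ, this, update_of_ne (one_ne_zero : (1 : Fin (m + 2)) ≠ 0)]
  let ρ : (Fin (m + 2) → A) → Perm A := fun x => if x 0 = a then 1 else τ
  have hρ : ∀ j, j ≠ 0 → ∀ x c, ρ (update x j c) = ρ x := by
    intro j hj x c
    simp only [ρ, update_of_ne hj.symm]
  let g : Fin (m + 2) → Perm (Fin (m + 2) → A) := fun j =>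
    if hj : j = 0 then updatePerm 0 σ hσ else updatePerm j ρ (hρ j hj)
  have g_zero : ∀ x, g 0 x = update x 0 (σ x (x 0)) := fun x => by
    simp only [g, dif_pos, updatePerm_apply]
  have g_ne : ∀ j, j ≠ 0 → ∀ x, g j x = update x j (ρ x (x j)) := fun j hj x => by
    simp only [g, dif_neg hj, updatePerm_apply]
  refine ⟨g, fun j x i hij => ?_, ?_⟩
  · by_cases hj : j = 0
    · subst hj
      rw [g_zero, update_of_ne hij]
    · rw [g_ne j hj, update_of_ne hij]
  refine closure_eq_top_of_swap_mem _ (fun _ => a) (update (fun _ => a) 0 b) ?_ ?_ ?_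
  · rw [← updatePerm_pow_eq_swap 0 a b σ hσ 3]
    · have hmem : updatePerm 0 σ hσ ∈ Set.range g := ⟨0, dif_pos rfl⟩
      exact Subgroup.pow_mem _ (Subgroup.subset_closure hmem) _
    · simp [σ, pow_succ]
    · rintro x ⟨i, hi, hx⟩
      have hx' : ¬ ∀ i, i ≠ 0 → x i = a := fun h => hx (h i hi)
      simp only [σ, if_neg hx']
      rw [swap_comm a b]
      have := Perm.isThreeCycle_swap_mul_swap_same hab.symm (ht (x 1)).2.symm (ht (x 1)).1.symm
      rw [← this.orderOf, pow_orderOf_eq_one]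
  · rintro _ ⟨j, rfl⟩
    by_cases hj : j = 0
    · subst hj
      right; left
      simp [g_zero, σ]
    · left
      simp [g_ne j hj, ρ]
  · intro S ha hS
    replace hS : ∀ j, ∀ x ∈ S, g j x ∈ S := fun j => hS _ ⟨j, rfl⟩
    have spread {c : A} (hc : c ≠ a) {x y : Fin (m + 2) → A} (hx : x ∈ S) (hxc : x 0 = c)
        (hyc : y 0 = c) : y ∈ S := by
      refine (mem_of_forall_update_mem (S := {x | x ∈ S ∧ x 0 = c}) (J := {j | j ≠ 0})
        (fun x hx j hj e => update_mem_of_forall_pow hτ' ?_ hx e) ⟨hx, hxc⟩ ?_).1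
      · rintro x ⟨hx, hxc⟩
        refine ⟨?_, by rwa [update_of_ne (Ne.symm hj)]⟩
        have := hS j x hx
        rwa [g_ne j hj, show ρ x = τ by simp [ρ, hxc, hc]] at this
      · intro i hi
        rw [not_not.1 hi, hxc, hyc]
    have half_b : ∀ y : Fin (m + 2) → A, y 0 = b → y ∈ S := by
      intro y hy
      have := hS 0 _ ha
      rw [g_zero] at this
      refine spread hab.symm this ?_ hy
      simp [σ]
    have line : ∀ y : Fin (m + 2) → A, (∃ i, i ≠ 0 ∧ y i ≠ a) →
        update y 0 (t (y 1)) ∈ S ∧ update y 0 a ∈ S := by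
      rintro y ⟨i, hi, hy⟩
      have hσy : σ y = swap a b * swap b (t (y 1)) := if_neg fun h => hy (h i hi)
      have h₁ := hS 0 _ (half_b (update y 0 b) (update_self ..))
      rw [g_zero, hσ, update_self, update_idem, hσy, Perm.mul_apply, swap_apply_left,
        swap_apply_of_ne_of_ne (ht _).1 (ht _).2] at h₁
      have h₂ := hS 0 _ h₁
      rw [g_zero, hσ, update_self, update_idem, hσy, Perm.mul_apply, swap_apply_right,
        swap_apply_right] at h₂
      exact ⟨h₁, h₂⟩
    intro y
    by_cases hyb : y 0 = b
    · exact half_b y hyb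
    by_cases hya : y 0 = a
    · by_cases hy : ∃ i, i ≠ 0 ∧ y i ≠ a
      · have := (line y hy).2
        rwa [← hya, update_eq_self] at this
      · push Not at hy
        convert ha with i
        by_cases hi : i = 0
        · rw [hi, hya]
        · exact hy i hi
    · have h₁ := (line (fun _ => y 0) ⟨1, one_ne_zero, hya⟩).1
      refine spread hya h₁ ?_ rfl
      simp [t, hya, hyb]

theorem exists_generating_instructions_of_card_eq_two {m : ℕ} {A : Type*} [Fintype A]
    [DecidableEq A] (hA : Fintype.card A = 2) :
    ∃ g : Fin (m + 3) → Perm (Fin (m + 3) → A),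
      (∀ j x i, i ≠ j → g j x i = x i) ∧ Subgroup.closure (Set.range g) = ⊤ := by
  obtain ⟨a, b, hab, huniv⟩ := Finset.card_eq_two.1 hA
  replace huniv (c : A) : c = a ∨ c = b := by simpa [huniv] using Finset.mem_univ c
  have hτ : ∀ c d : A, ∃ k : ℕ, (swap a b ^ k) c = d := by
    intro c d
    by_cases hcd : c = d
    · exact ⟨0, hcd⟩
    · refine ⟨1, ?_⟩
      rcases huniv c with rfl | rfl <;> rcases huniv d with rfl | rfl <;> simp_all
  have h10 : (1 : Fin (m + 3)) ≠ 0 := one_ne_zero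
  have h20 : (2 : Fin (m + 3)) ≠ 0 := by
    rw [Ne, Fin.ext_iff, Fin.coe_ofNat_eq_mod, Nat.mod_eq_of_lt (by omega)]
    simp
  have h21 : (2 : Fin (m + 3)) ≠ 1 := by
    rw [Ne, Fin.ext_iff, Fin.coe_ofNat_eq_mod, Nat.mod_eq_of_lt (by omega)]
    simp
  let σ : Fin (m + 3) → (Fin (m + 3) → A) → Perm A := fun j x =>
    if j = 0 then if ∀ i, i ≠ 0 → x i = a then swap a b else 1
    else if j = 1 then if x 0 = a ∧ x 2 = a then 1 else swap a b
    else if x 0 = b ∧ x 1 = a then 1 else swap a b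
  have hσ : ∀ j x c, σ j (update x j c) = σ j x := by
    intro j x c
    by_cases hj0 : j = 0
    · subst hj0
      have : (∀ i, i ≠ 0 → update x 0 c i = a) ↔ ∀ i, i ≠ 0 → x i = a :=
        forall₂_congr fun i hi => by rw [update_of_ne hi]
      simp only [σ, this, ↓reduceIte]
    by_cases hj1 : j = 1
    · subst hj1
      simp only [σ, h10, update_of_ne h10.symm, update_of_ne h21, ↓reduceIte]
    · simp only [σ, hj0, hj1, update_of_ne (Ne.symm hj0), update_of_ne (Ne.symm hj1),
        ↓reduceIte]
  let g : Fin (m + 3) → Perm (Fin (m + 3) → A) := fun j => updatePerm j (σ j) (hσ j)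
  have g_apply : ∀ j x, g j x = update x j (σ j x (x j)) := fun j x => rfl
  refine ⟨g, fun j x i hij => by rw [g_apply, update_of_ne hij], ?_⟩
  refine closure_eq_top_of_swap_mem _ (fun _ => a) (update (fun _ => a) 0 b) ?_ ?_ ?_
  · rw [← updatePerm_pow_eq_swap 0 a b (σ 0) (hσ 0) 1]
    · rw [pow_one]
      exact Subgroup.subset_closure ⟨0, rfl⟩
    · simp [σ]
    · rintro x ⟨i, hi, hx⟩
      have hx' : ¬ ∀ i, i ≠ 0 → x i = a := fun h => hx (h i hi)
      simp only [σ, if_neg hx', if_true, pow_one]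
  · rintro _ ⟨j, rfl⟩
    by_cases hj0 : j = 0
    · subst hj0
      right; left
      simp [g_apply, σ]
    by_cases hj1 : j = 1
    · subst hj1
      left
      simp [g_apply, σ]
    · right; right
      simp [g_apply, σ, hj0, hj1]
  · intro S ha hS
    replace hS : ∀ j, ∀ x ∈ S, g j x ∈ S := fun j => hS _ ⟨j, rfl⟩
    have flip {j : Fin (m + 3)} {x : Fin (m + 3) → A} (hx : x ∈ S) (hj : σ j x = swap a b)
        (c : A) : update x j c ∈ S := by
      refine (update_mem_of_forall_pow (S := {x | x ∈ S ∧ σ j x = swap a b}) hτ ?_ ⟨hx, hj⟩ c).1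
      rintro x ⟨hx, hj⟩
      refine ⟨?_, by rw [hσ, hj]⟩
      have := hS j x hx
      rwa [g_apply, hj] at this
    have half_a : ∀ y : Fin (m + 3) → A, y 0 = a → y ∈ S := by
      have spread : ∀ y : Fin (m + 3) → A, y 0 = a → y 1 = a → y ∈ S := by
        intro y hy0 hy1
        refine (mem_of_forall_update_mem (S := {x | x ∈ S ∧ x 0 = a})
          (J := {j | j ≠ 0 ∧ j ≠ 1}) ?_ ⟨ha, rfl⟩ ?_).1
        · rintro x ⟨hx, hx0⟩ j ⟨hj0, hj1⟩ c
          refine ⟨flip hx ?_ c, by rwa [update_of_ne (Ne.symm hj0)]⟩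
          simp [σ, hj0, hj1, hx0, hab]
        · intro i hi
          by_cases hi0 : i = 0
          · rw [hi0, hy0]
          · rw [not_not.1 fun h => hi ⟨hi0, h⟩, hy1]
      have half : ∀ y : Fin (m + 3) → A, y 0 = a → y 2 = b → y ∈ S := by
        intro y hy0 hy2
        have := flip (j := 1) (spread (update y 1 a) (by rwa [update_of_ne h10.symm])
          (update_self ..)) (by simp [σ, h21, hy2, hab.symm]) (y 1)
        rwa [update_idem, update_eq_self] at this
      intro y hy0
      have := flip (j := 2) (half (update y 2 b) (by rwa [update_of_ne h20.symm])
        (update_self ..)) (by simp [σ, h20, h21, h20.symm, hy0, hab]) (y 2)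
      rwa [update_idem, update_eq_self] at this
    have half_b : ∀ y : Fin (m + 3) → A, y 0 = b → y ∈ S := by
      have hb : update (update (fun _ => a) 0 b) 1 b ∈ S :=
        flip (flip ha (by simp [σ]) b) (by simp [σ, hab.symm]) b
      have half : ∀ y : Fin (m + 3) → A, y 0 = b → y 1 = b → y ∈ S := by
        intro y hy0 hy1
        refine (mem_of_forall_update_mem (S := {x | x ∈ S ∧ x 0 = b ∧ x 1 = b})
          (J := {j | j ≠ 0 ∧ j ≠ 1}) ?_ ⟨hb, by simp [h10.symm], by simp⟩ ?_).1
        · rintro x ⟨hx, hx0, hx1⟩ j ⟨hj0, hj1⟩ c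
          refine ⟨flip hx ?_ c, by rwa [update_of_ne (Ne.symm hj0)],
            by rwa [update_of_ne (Ne.symm hj1)]⟩
          simp [σ, hj0, hj1, hx1, hab.symm]
        · intro i hi
          by_cases hi0 : i = 0
          · simp [hi0, hy0]
          · rw [not_not.1 fun h => hi ⟨hi0, h⟩, hy1, update_self]
      intro y hy0
      have := flip (j := 1) (half (update y 1 b) (by rwa [update_of_ne h10.symm])
        (update_self ..)) (by simp [σ, hy0, hab.symm]) (y 1)
      rwa [update_idem, update_eq_self] at this
    intro y
    exact (huniv (y 0)).elim (half_a y) (half_b y)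

/-- Unless `q = n = 2`, the symmetric group `Sym(A^n)` is generated by `n`
instructions. -/
theorem symmetric_generated_by_n_instructions
    (q n : ℕ) (A : Type*) [Fintype A] [DecidableEq A]
    (hA : Fintype.card A = q) (hq : 2 ≤ q) (hn : 2 ≤ n)
    (h : ¬ (q = 2 ∧ n = 2)) :
    ∃ X : Finset (Equiv.Perm (Fin n → A)),
      X.card = n ∧ (∀ g ∈ X, IsInstruction g) ∧
      Subgroup.closure (X : Set (Equiv.Perm (Fin n → A))) = ⊤ := by
  have : Nontrivial A := Fintype.one_lt_card_iff_nontrivial.1 (by omega)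
  suffices ∃ g : Fin n → Perm (Fin n → A),
      (∀ j x i, i ≠ j → g j x i = x i) ∧ Subgroup.closure (Set.range g) = ⊤ by
    obtain ⟨g, hg, htop⟩ := this
    exact exists_finset_of_closure_range_eq_top g hg htop
  rcases hq.lt_or_eq with hq | rfl
  · obtain ⟨m, rfl⟩ := Nat.exists_eq_add_of_le' hn
    exact exists_generating_instructions_of_two_lt_card (hA ▸ hq)
  · obtain ⟨m, rfl⟩ := Nat.exists_eq_add_of_le' (show 3 ≤ n by omega)
    exact exists_generating_instructions_of_card_eq_two hA
end

section
/- If q ≥ 3 and n ≥ 2, then there exists a set X of instructions on A^n with |X| = n, each element of which is an even permutation of A^n, such that X generates the alternating group Alt(A^n). -/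
open Equiv Equiv.Perm MulAction Pointwise in
/-- A transitive group generated by a set `X` that contains a 3-cycle `(a c b)` is primitive, hence
contains the alternating group, as soon as every element of `X` sends some point of `{a, b, c}`
into `{a, b, c}`. -/
theorem alternatingGroup_le_closure_of_swap_mul_swap_mem {α : Type*} [Fintype α] [DecidableEq α]
    {X : Set (Perm α)} {a b c : α} (hab : a ≠ b) (hac : a ≠ c) (hbc : b ≠ c)
    (ht : swap a b * swap a c ∈ Subgroup.closure X)
    (htrans : ∀ x, ∃ g ∈ Subgroup.closure X, g a = x)
    (hX : ∀ g ∈ X, ∃ p ∈ ({a, b, c} : Set α), g p ∈ ({a, b, c} : Set α)) :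
    alternatingGroup α ≤ Subgroup.closure X := by
  have hpre : IsPretransitive (Subgroup.closure X) α := by
    rw [isPretransitive_iff_base a]
    intro x
    obtain ⟨g, hg, hgx⟩ := htrans x
    exact ⟨⟨g, hg⟩, hgx⟩
  refine alternatingGroup_le_of_isPreprimitive_of_isThreeCycle_mem ?_
    (isThreeCycle_swap_mul_swap_same hab hac hbc) ht
  refine IsPreprimitive.of_isTrivialBlock_base a fun {B} haB hB => ?_
  rw [IsTrivialBlock, or_iff_not_imp_left]
  intro hns
  obtain ⟨w, hwB, hwa⟩ : ∃ w ∈ B, w ≠ a := by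
    by_contra! h
    exact hns fun x hx y hy => (h x hx).trans (h y hy).symm
  have hmove : ∀ g ∈ Subgroup.closure X, ∀ p ∈ B, g p ∈ B → ∀ x ∈ B, g x ∈ B := by
    intro g hg p hp hgp x hx
    have h := hB.smul_eq_of_mem (g := ⟨g, hg⟩) hp hgp
    rw [← h]
    exact Set.smul_mem_smul_set hx
  have hta : (swap a b * swap a c) a = c := by
    simp [swap_apply_of_ne_of_ne hac.symm hbc.symm]
  have htb : (swap a b * swap a c) b = a := by
    simp [swap_apply_of_ne_of_ne hab.symm hbc]
  have htc : (swap a b * swap a c) c = b := by simp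
  have hinv : ∀ x ∈ B, (swap a b * swap a c) x ∈ B := by
    by_cases hwb : w = b
    · exact hmove _ ht b (hwb ▸ hwB) (by rwa [htb])
    by_cases hwc : w = c
    · exact hmove _ ht a haB (by rw [hta]; exact hwc ▸ hwB)
    · refine hmove _ ht w hwB ?_
      rwa [Perm.mul_apply, swap_apply_of_ne_of_ne hwa hwc, swap_apply_of_ne_of_ne hwa hwb]
  have hcB : c ∈ B := hta ▸ hinv a haB
  have hbB : b ∈ B := htc ▸ hinv c hcB
  have hsub : ({a, b, c} : Set α) ⊆ B := by
    rintro x (rfl | rfl | rfl) <;> assumption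
  have hstab : Subgroup.closure X ≤ stabilizer (Perm α) B := by
    rw [Subgroup.closure_le]
    intro g hg
    obtain ⟨p, hp, hgp⟩ := hX g hg
    exact hB.smul_eq_of_mem (g := ⟨g, Subgroup.subset_closure hg⟩) (hsub hp) (hsub hgp)
  refine Set.eq_univ_of_forall fun x => ?_
  obtain ⟨g, hg, rfl⟩ := htrans x
  rw [← mem_stabilizer_iff.1 (hstab hg)]
  exact Set.smul_mem_smul_set haB

section lineAction

variable {ι A : Type*} [DecidableEq ι]

/-- The permutation of `ι → A` that updates the coordinate `j` by the permutation `σ c`, where `c`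
is the restriction of the state to the other coordinates. -/
def lineAction (j : ι) : (({i // i ≠ j} → A) → Equiv.Perm A) →* Equiv.Perm (ι → A) where
  toFun σ := (Equiv.funSplitAt j A).symm.permCongr (Equiv.prodCongrLeft σ)
  map_one' := by
    ext1 x
    simp [Equiv.permCongr_apply, Equiv.prodCongrLeft, -Equiv.funSplitAt_apply]
  map_mul' σ τ := by
    ext x i
    simp [Equiv.permCongr_apply, Equiv.prodCongrLeft]

theorem lineAction_apply (j : ι) (σ : ({i // i ≠ j} → A) → Equiv.Perm A) (x : ι → A) :
    lineAction j σ x = Function.update x j (σ (fun i => x i) (x j)) := by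
  ext i
  by_cases h : i = j
  · subst h
    simp [lineAction, Equiv.permCongr_apply, Equiv.prodCongrLeft, Equiv.funSplitAt]
  · simp [lineAction, Equiv.permCongr_apply, Equiv.prodCongrLeft, Equiv.funSplitAt, h]

theorem lineAction_apply_of_ne {i j : ι} (h : i ≠ j) (σ : ({i // i ≠ j} → A) → Equiv.Perm A)
    (x : ι → A) : lineAction j σ x i = x i := by
  rw [lineAction_apply, Function.update_of_ne h]

theorem lineAction_mulSingle_swap [Fintype ι] [DecidableEq A] (j : ι) (z : ι → A) (a b : A) :
    lineAction j (Pi.mulSingle (fun i : {i // i ≠ j} => z i) (Equiv.swap a b)) =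
      Equiv.swap (Function.update z j a) (Function.update z j b) := by
  ext1 x
  rw [lineAction_apply]
  by_cases h : (fun i : {i // i ≠ j} => x i) = fun i : {i // i ≠ j} => z i
  · obtain ⟨d, rfl⟩ : ∃ d, x = Function.update z j d := by
      refine ⟨x j, ?_⟩
      ext i
      by_cases hi : i = j
      · subst hi; simp
      · simpa [hi] using congrFun h ⟨i, hi⟩
    have hinj := Function.update_injective z j
    rw [h, Pi.mulSingle_eq_same, Function.update_self, Function.update_idem, hinj.swap_apply]
  · have hne : ∀ d, x ≠ Function.update z j d := by
      rintro d rfl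
      apply h
      ext i
      simp [i.2]
    rw [Pi.mulSingle_eq_of_ne h, Equiv.swap_apply_of_ne_of_ne (hne a) (hne b)]
    simp

theorem sign_lineAction [Fintype ι] [Fintype A] [DecidableEq A] (j : ι)
    (σ : ({i // i ≠ j} → A) → Equiv.Perm A) :
    Equiv.Perm.sign (lineAction j σ) = ∏ c, Equiv.Perm.sign (σ c) := by
  rw [← Equiv.Perm.sign_prodCongrLeft]
  exact Equiv.Perm.sign_permCongr _ _

end lineAction

section Generators

open Equiv Equiv.Perm

variable {ι A : Type*} [Fintype ι] [DecidableEq ι] [Fintype A] [DecidableEq A]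

/-- An even update of the register `j` that acts by `s` where the register `o` differs from `a₁`, and
fixes every state whose registers `o` and `j` hold `a₁` and `a₀`. -/
theorem exists_even_lineAction_eq_of_ne {o j : ι} (hoj : o ≠ j) {a₀ a₁ a₂ : A} (h01 : a₀ ≠ a₁)
    (h02 : a₀ ≠ a₂) (h12 : a₁ ≠ a₂) (s : Perm A) :
    ∃ τ : ({i // i ≠ j} → A) → Perm A, sign (lineAction j τ) = 1 ∧
      (∀ c, c ⟨o, hoj⟩ ≠ a₁ → τ c = s) ∧ ∀ c, c ⟨o, hoj⟩ = a₁ → τ c a₀ = a₀ := by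
  let σ : ({i // i ≠ j} → A) → Perm A := fun c => if c ⟨o, hoj⟩ = a₁ then 1 else s
  rcases Int.units_eq_one_or (sign (lineAction j σ)) with h | h
  · refine ⟨σ, h, fun c hc => ?_, fun c hc => ?_⟩ <;> simp [σ, hc]
  · refine ⟨σ * Pi.mulSingle (fun _ => a₁) (swap a₁ a₂), ?_, fun c hc => ?_, fun c hc => ?_⟩
    · rw [map_mul, map_mul, h, lineAction_mulSingle_swap j (fun _ => a₁), sign_swap]
      · rfl
      · exact fun h => h12 (Function.update_injective _ _ h)
    · have : c ≠ fun _ => a₁ := by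
        rintro rfl
        exact hc rfl
      simp [σ, hc, Pi.mulSingle_eq_of_ne this]
    · by_cases hc' : c = fun _ => a₁
      · subst hc'
        simp [σ, swap_apply_of_ne_of_ne h01 h02]
      · simp [σ, hc, Pi.mulSingle_eq_of_ne hc']

/-- An even update of the register `o` that acts as a 3-cycle on one line, and as involutions on
the others. The fourth power of this update is thus a 3-cycle. -/
theorem exists_even_lineAction_threeCycle {o k : ι} (hko : k ≠ o) {a₀ a₁ a₂ : A} (h01 : a₀ ≠ a₁)
    (h02 : a₀ ≠ a₂) (h12 : a₁ ≠ a₂) :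
    ∃ τ : ({i // i ≠ o} → A) → Perm A, sign (lineAction o τ) = 1 ∧
      (τ fun _ => a₀) = swap a₀ a₁ * swap a₀ a₂ ∧
      (∀ c, (c ≠ fun _ => a₀) → τ c ^ 2 = 1 ∧ τ c a₁ = a₀) ∧
      ∀ a, a ≠ a₀ → a ≠ a₁ → a ≠ a₂ → ∃ c, (c ≠ fun _ => a₀) ∧ τ c a = a₂ := by
  obtain ⟨a₃, h03, h13, h3⟩ : ∃ a₃, a₀ ≠ a₃ ∧ a₁ ≠ a₃ ∧
      (a₂ ≠ a₃ ∨ a₂ = a₃ ∧ Finset.univ = ({a₀, a₁, a₂} : Finset A)) := by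
    by_cases h : Finset.univ = ({a₀, a₁, a₂} : Finset A)
    · exact ⟨a₂, h02, h12, .inr ⟨rfl, h⟩⟩
    · obtain ⟨x, hx⟩ : ∃ x, x ∉ ({a₀, a₁, a₂} : Finset A) := by
        by_contra! hx
        exact h (Finset.eq_univ_iff_forall.2 hx).symm
      simp only [Finset.mem_insert, Finset.mem_singleton, not_or] at hx
      exact ⟨x, Ne.symm hx.1, Ne.symm hx.2.1, .inl (Ne.symm hx.2.2)⟩
  let f : A → A := fun r => if r ≠ a₀ ∧ r ≠ a₁ ∧ r ≠ a₂ then r else a₃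
  have hf0 : ∀ r, f r ≠ a₀ := by grind
  have hf1 : ∀ r, f r ≠ a₁ := by grind
  let τ : ({i // i ≠ o} → A) → Perm A := fun c =>
    if c = fun _ => a₀ then swap a₀ a₁ * swap a₀ a₂ else swap a₀ a₁ * swap a₂ (f (c ⟨k, hko⟩))
  refine ⟨τ, ?_, by simp [τ], fun c hc => ⟨?_, ?_⟩, fun a ha0 ha1 ha2 => ?_⟩
  · rw [sign_lineAction]
    rcases h3 with h3 | ⟨rfl, huniv⟩
    · refine Finset.prod_eq_one fun c _ => ?_
      have hf2 : ∀ r, a₂ ≠ f r := by grind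
      by_cases hc : c = fun _ => a₀
      · simp [τ, hc, sign_swap h01, sign_swap h02]
      · simp [τ, hc, sign_swap h01, sign_swap (hf2 _)]
    · have hf2 : ∀ r, f r = a₂ := by
        intro r
        have := Finset.mem_univ r
        rw [huniv] at this
        grind
      have hτ : ∀ c, sign (τ c) = if c = fun _ => a₀ then 1 else -1 := by
        intro c
        by_cases hc : c = fun _ => a₀
        · simp [τ, hc, sign_swap h01, sign_swap h02]
        · simp [τ, hc, sign_swap h01, hf2]
      have hcard : Fintype.card A = 3 := by
        rw [← Finset.card_univ, huniv, Finset.card_eq_three.2 ⟨_, _, _, h01, h02, h12, rfl⟩]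
      simp only [hτ, Finset.prod_ite, Finset.prod_const_one, one_mul, Finset.prod_const]
      rw [Finset.filter_ne' Finset.univ (fun _ => a₀), Finset.card_erase_of_mem (Finset.mem_univ _),
        Finset.card_univ, Fintype.card_fun, hcard]
      exact Even.neg_one_pow (Nat.Odd.sub_odd (Odd.pow (by decide)) odd_one)
  · ext x
    simp only [τ, hc, if_false, pow_two, Perm.mul_apply, Perm.one_apply, swap_apply_def]
    have := hf0 (c ⟨k, hko⟩)
    have := hf1 (c ⟨k, hko⟩)
    generalize f (c ⟨k, hko⟩) = r at *
    clear_value τ f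
    split_ifs <;> simp_all
  · simp [τ, hc, swap_apply_of_ne_of_ne h12 (hf1 _).symm]
  · refine ⟨fun _ => a, fun h => ha0 (congrFun h ⟨k, hko⟩), ?_⟩
    have hne : (fun _ : {i // i ≠ o} => a) ≠ fun _ => a₀ := fun h => ha0 (congrFun h ⟨k, hko⟩)
    simp [τ, hne, f, ha0, ha1, ha2, swap_apply_of_ne_of_ne h02.symm h12.symm]

theorem exists_even_lineActions_closure_eq_alternatingGroup {o k : ι} (hko : k ≠ o)
    (hA : 3 ≤ Fintype.card A) :
    ∃ g : ι → Perm (ι → A), (∀ j x i, i ≠ j → g j x i = x i) ∧ (∀ j, g j ≠ 1) ∧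
      Subgroup.closure (Set.range g) = alternatingGroup (ι → A) := by
  obtain ⟨a₀, a₁, a₂, h01, h02, h12⟩ := Fintype.two_lt_card_iff.1 hA
  obtain ⟨s, hs, -⟩ := Finset.exists_cycleOn (Finset.univ : Finset A)
  obtain ⟨τ, hτsign, hτ0, hτ1, hτ2⟩ := exists_even_lineAction_threeCycle hko h01 h02 h12
  choose ρ hρsign hρs hρ0 using fun (j : ι) (h : o ≠ j) =>
    exists_even_lineAction_eq_of_ne h h01 h02 h12 s
  let g : ι → Perm (ι → A) := fun j =>
    if h : o ≠ j then lineAction j (ρ j h) else lineAction o τ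
  have hgo : g o = lineAction o τ := by simp [g]
  have hgj : ∀ j (h : o ≠ j), g j = lineAction j (ρ j h) := fun j h => by simp [g, h]
  have hfix : ∀ j x i, i ≠ j → g j x i = x i := by
    intro j x i hij
    by_cases h : o = j
    · subst h
      rw [hgo, lineAction_apply_of_ne hij]
    · rw [hgj j h, lineAction_apply_of_ne hij]
  have hsign : ∀ j, g j ∈ alternatingGroup (ι → A) := by
    intro j
    rw [mem_alternatingGroup]
    by_cases h : o = j
    · subst h
      rw [hgo, hτsign]
    · rw [hgj j h, hρsign]
  set G := Subgroup.closure (Set.range g)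
  have hmem : ∀ j, g j ∈ G := fun j => Subgroup.subset_closure ⟨j, rfl⟩
  let R : (ι → A) → (ι → A) → Prop := fun x y => ∃ u ∈ G, u x = y
  have hRrefl : ∀ x, R x x := fun x => ⟨1, G.one_mem, rfl⟩
  have hRsymm : ∀ {x y}, R x y → R y x := by
    rintro x _ ⟨u, hu, rfl⟩
    exact ⟨u⁻¹, G.inv_mem hu, by simp⟩
  have hRtrans : ∀ {x y z}, R x y → R y z → R x z := by
    rintro x _ _ ⟨u, hu, rfl⟩ ⟨v, hv, rfl⟩
    exact ⟨v * u, G.mul_mem hv hu, rfl⟩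
  have hRo : ∀ x, R x (Function.update x o (τ (fun i => x i) (x o))) := fun x =>
    ⟨g o, hmem o, by rw [hgo, lineAction_apply]⟩
  have hRj : ∀ x j b, o ≠ j → x o ≠ a₁ → R x (Function.update x j b) := by
    intro x j b hj hx
    obtain ⟨m, hm⟩ := hs.exists_pow_eq' (Finset.finite_toSet _) (a := x j) (b := b)
      (by simp) (by simp)
    refine ⟨g j ^ m, G.pow_mem (hmem j) m, ?_⟩
    rw [hgj j hj, ← map_pow, lineAction_apply, Pi.pow_apply, hρs j hj _ hx, hm]
  have hRlayer : ∀ (S : Finset ι) (x y : ι → A), x o = y o → x o ≠ a₁ → (∀ i ∉ S, x i = y i) →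
      R x y := by
    intro S
    induction S using Finset.induction_on with
    | empty =>
      intro x y _ _ h
      obtain rfl : x = y := funext fun i => h i (by simp)
      exact hRrefl x
    | insert j S _ ih =>
      intro x y hxy hx h
      by_cases hj : o = j
      · subst hj
        exact ih x y hxy hx fun i hi => by
          by_cases hio : i = o
          · rw [hio, hxy]
          · exact h i (by simp [hio, hi])
      · refine hRtrans (hRj x j (y j) hj hx) (ih _ _ ?_ ?_ fun i hi => ?_)
        · rwa [Function.update_of_ne hj]
        · rwa [Function.update_of_ne hj]
        · by_cases hij : i = j
          · subst hij; simp
          · rw [Function.update_of_ne hij]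
            exact h i (by simp [hij, hi])
  let P : A → ι → A := Function.update (fun _ => a₀) o
  have hPo : ∀ a, P a o = a := fun a => by simp [P]
  have hPne : ∀ a i, i ≠ o → P a i = a₀ := fun a i h => by simp [P, h]
  have hPres : ∀ a, (fun i : {i // i ≠ o} => P a i) = fun _ => a₀ := fun a =>
    funext fun i => hPne a i i.2
  have hPinj : ∀ {a b}, a ≠ b → P a ≠ P b := fun hab h =>
    hab (Function.update_injective _ _ h)
  have hPstep : ∀ a b, (swap a₀ a₁ * swap a₀ a₂) a = b → R (P a) (P b) := by
    rintro a _ rfl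
    have := hRo (P a)
    rwa [hPres, hτ0, hPo, Function.update_idem] at this
  have hP02 : R (P a₀) (P a₂) :=
    hPstep _ _ (by simp [swap_apply_of_ne_of_ne h02.symm h12.symm])
  have hP01 : R (P a₀) (P a₁) := hRtrans hP02 (hPstep _ _ (by simp))
  have hRlayer' : ∀ {x y : ι → A}, x o = y o → x o ≠ a₁ → R x y := fun hxy hx =>
    hRlayer Finset.univ _ _ hxy hx (by simp)
  have hP : ∀ a, R (P a₀) (P a) := by
    intro a
    by_cases ha0 : a = a₀
    · rw [ha0]; exact hRrefl _
    by_cases ha1 : a = a₁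
    · rwa [ha1]
    by_cases ha2 : a = a₂
    · rwa [ha2]
    obtain ⟨c, -, hca⟩ := hτ2 a ha0 ha1 ha2
    let y : ι → A := fun i => if h : i ≠ o then c ⟨i, h⟩ else a
    have hyo : y o = a := by simp [y]
    have hyc : (fun i : {i // i ≠ o} => y i) = c := by
      ext i
      simp [y, i.2]
    have hy := hRo y
    rw [hyo, hyc, hca] at hy
    refine hRtrans hP02 (hRtrans (hRlayer' ?_ ?_) (hRtrans (hRsymm hy) (hRlayer' ?_ ?_)))
    · simp [hPo]
    · rw [hPo]; exact h12.symm
    · rw [hPo, hyo]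
    · rwa [hyo]
  have htrans : ∀ x, R (P a₀) x := by
    intro x
    by_cases hx : x o = a₁
    · by_cases hc : (fun i : {i // i ≠ o} => x i) = fun _ => a₀
      · have : x = P a₁ := by
          ext i
          by_cases hi : i = o
          · rw [hi, hx, hPo]
          · rw [hPne _ _ hi]
            exact congrFun hc ⟨i, hi⟩
        rw [this]
        exact hP a₁
      · have h := hRo x
        rw [hx, (hτ1 _ hc).2] at h
        refine hRtrans (hRlayer' ?_ ?_) (hRsymm h)
        · simp [hPo]
        · rwa [hPo]
    · exact hRtrans (hP (x o)) (hRlayer' (hPo _) (by rwa [hPo]))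
  have hτ4 : τ ^ 4 = Pi.mulSingle (fun _ => a₀) (swap a₀ a₁ * swap a₀ a₂) := by
    ext1 c
    by_cases hc : c = fun _ => a₀
    · subst hc
      have h3 : (swap a₀ a₁ * swap a₀ a₂) ^ 3 = 1 := by
        rw [← (isThreeCycle_swap_mul_swap_same h01 h02 h12).orderOf, pow_orderOf_eq_one]
      rw [Pi.mulSingle_eq_same, Pi.pow_apply, hτ0, pow_succ, h3, one_mul]
    · rw [Pi.mulSingle_eq_of_ne hc, Pi.pow_apply, pow_mul (τ c) 2 2, (hτ1 c hc).1, one_pow]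
  have ht : swap (P a₀) (P a₁) * swap (P a₀) (P a₂) ∈ G := by
    have h := G.pow_mem (hmem o) 4
    rwa [hgo, ← map_pow, hτ4, Pi.mulSingle_mul, map_mul,
      lineAction_mulSingle_swap o (fun _ => a₀), lineAction_mulSingle_swap o (fun _ => a₀)] at h
  have hgP : ∀ j, o ≠ j → g j (P a₁) = P a₁ := by
    intro j hj
    rw [hgj j hj, lineAction_apply, hPne _ _ hj.symm, hρ0 j hj _ (hPo _), ← hPne a₁ j hj.symm,
      Function.update_eq_self]
  refine ⟨g, hfix, fun j hj => ?_, le_antisymm ?_ ?_⟩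
  · have h := congrFun (DFunLike.congr_fun hj (P a₀)) j
    rw [Perm.one_apply] at h
    by_cases hoj : o = j
    · subst hoj
      rw [hgo, lineAction_apply, hPres, hτ0, hPo, Function.update_self] at h
      exact h02.symm (by simpa [swap_apply_of_ne_of_ne h02.symm h12.symm] using h)
    · rw [hgj j hoj, lineAction_apply, Function.update_self, hPne _ _ (Ne.symm hoj),
        hρs j hoj _ (by rwa [hPo])] at h
      refine hs.apply_ne ?_ (Finset.mem_coe.2 (Finset.mem_univ a₀)) h
      exact ⟨a₀, by simp, a₁, by simp, h01⟩
  · refine (Subgroup.closure_le _).2 ?_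
    rintro _ ⟨j, rfl⟩
    exact hsign j
  · refine alternatingGroup_le_closure_of_swap_mul_swap_mem (hPinj h01) (hPinj h02) (hPinj h12) ht
      htrans ?_
    rintro _ ⟨j, rfl⟩
    by_cases hj : o = j
    · subst hj
      refine ⟨P a₂, by simp, ?_⟩
      rw [hgo, lineAction_apply, hPres, hτ0, hPo, Function.update_idem]
      simp [P]
    · exact ⟨P a₁, by simp, by simp [hgP j hj]⟩

end Generators

/-- If `q ≥ 3`, the alternating group `Alt(A^n)` is generated by `n` even
instructions. -/
theorem alternating_generated_by_n_instructions
    (q n : ℕ) (A : Type*) [Fintype A] [DecidableEq A]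
    (hA : Fintype.card A = q) (hq : 3 ≤ q) (hn : 2 ≤ n) :
    ∃ X : Finset (Equiv.Perm (Fin n → A)),
      X.card = n ∧
      (∀ g ∈ X, IsInstruction g ∧ g ∈ alternatingGroup (Fin n → A)) ∧
      Subgroup.closure (X : Set (Equiv.Perm (Fin n → A))) =
        alternatingGroup (Fin n → A) := by
  obtain ⟨g, hfix, hne, hclosure⟩ := exists_even_lineActions_closure_eq_alternatingGroup (A := A)
    (o := (⟨0, by omega⟩ : Fin n)) (k := ⟨1, by omega⟩) (by simp) (hA ▸ hq)
  have hinj : Function.Injective g := by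
    intro i j hij
    by_contra h
    refine hne i (Equiv.ext fun x => funext fun k => ?_)
    by_cases hk : k = i
    · rw [hij, hfix j x k (hk ▸ h), Equiv.Perm.one_apply]
    · rw [hfix i x k hk, Equiv.Perm.one_apply]
  refine ⟨Finset.univ.image g, ?_, fun u hu => ?_, ?_⟩
  · rw [Finset.card_image_of_injective _ hinj, Finset.card_univ, Fintype.card_fin]
  · obtain ⟨j, -, rfl⟩ := Finset.mem_image.1 hu
    exact ⟨⟨j, hfix j⟩, hclosure ▸ Subgroup.subset_closure ⟨j, rfl⟩⟩
  · rw [Finset.coe_image, Finset.coe_univ, Set.image_univ, hclosure]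
end

section
/- For every n ≥ 2, there exists a set of n instructions on {0,1,2}^n that generates the alternating group Alt({0,1,2}^n). -/
open Equiv Equiv.Perm MulAction

section Pairs

variable {V : Type*} [AddCommGroup V]

/-- The permutation of `{0,1,2} × V` rotating the fibre `{0,1,2} × {0}` and exchanging
`0` and `2` in every other fibre. -/
def rotateFlip (V : Type*) [AddCommGroup V] [DecidableEq V] : Perm (Fin 3 × V) :=
  prodCongrLeft fun v : V ↦ if v = 0 then finRotate 3 else swap 0 2

/-- The permutation `(a, w) ↦ (a, w ± v)`, where the sign is negative exactly for `a = 2`. -/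
def signedTranslate (v : V) : Perm (Fin 3 × V) :=
  prodCongrRight fun a : Fin 3 ↦ Equiv.addRight (if a = 2 then -v else v)

theorem signedTranslate_apply (v : V) (a : Fin 3) (w : V) :
    signedTranslate v (a, w) = (a, w + if a = 2 then -v else v) := rfl

theorem signedTranslate_zero : signedTranslate (0 : V) = 1 := by
  ext ⟨a, w⟩ <;> simp [signedTranslate_apply]

theorem signedTranslate_add (v w : V) :
    signedTranslate (v + w) = signedTranslate v * signedTranslate w := by
  ext ⟨a, u⟩
  · rfl
  · simp only [Perm.mul_apply, signedTranslate_apply]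
    split_ifs <;> abel

theorem signedTranslate_neg (v : V) : signedTranslate (-v) = (signedTranslate v)⁻¹ := by
  rw [eq_inv_iff_mul_eq_one, ← signedTranslate_add, neg_add_cancel, signedTranslate_zero]

theorem signedTranslate_mem {G : Subgroup (Perm (Fin 3 × V))} {S : Set V}
    (hS : AddSubgroup.closure S = ⊤) (hG : ∀ v ∈ S, signedTranslate v ∈ G) (v : V) :
    signedTranslate v ∈ G := by
  have hv : v ∈ AddSubgroup.closure S := hS ▸ AddSubgroup.mem_top v
  induction hv using AddSubgroup.closure_induction with
  | mem v hv => exact hG v hv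
  | zero => exact signedTranslate_zero (V := V) ▸ G.one_mem
  | add v w _ _ hv hw => exact signedTranslate_add v w ▸ G.mul_mem hv hw
  | neg v _ hv => exact signedTranslate_neg v ▸ G.inv_mem hv

variable [DecidableEq V]

theorem rotateFlip_apply (a : Fin 3) (v : V) :
    rotateFlip V (a, v) = ((if v = 0 then finRotate 3 else swap 0 2) a, v) := rfl

theorem rotateFlip_pow_apply (k : ℕ) (a : Fin 3) (v : V) :
    (rotateFlip V ^ k) (a, v) = (((if v = 0 then finRotate 3 else swap 0 2) ^ k) a, v) := by
  induction k with
  | zero => rfl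
  | succ k ih => rw [pow_succ', pow_succ', Perm.mul_apply, ih, rotateFlip_apply, Perm.mul_apply]

theorem rotateFlip_pow_three_apply (a : Fin 3) (v : V) :
    (rotateFlip V ^ 3) (a, v) = (if v = 0 then a else swap 0 2 a, v) := by
  rw [rotateFlip_pow_apply]
  split_ifs <;> congr 1 <;> revert a <;> decide

theorem rotateFlip_pow_four_apply (a : Fin 3) (v : V) :
    (rotateFlip V ^ 4) (a, v) = (if v = 0 then a + 1 else a, v) := by
  rw [rotateFlip_pow_apply]
  split_ifs <;> congr 1 <;> revert a <;> decide

theorem rotateFlip_pow_four :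
    rotateFlip V ^ 4 = swap ((0 : Fin 3), (0 : V)) (2, 0) * swap (0, 0) (1, 0) := by
  ext1 ⟨a, v⟩
  rw [rotateFlip_pow_four_apply]
  by_cases hv : v = 0
  · subst hv
    fin_cases a <;> simp [Perm.mul_apply, swap_apply_def]
  · simp [Perm.mul_apply, swap_apply_def, hv]

theorem isPreprimitive_of_mem (hV : ∀ v : V, v + v = -v) {G : Subgroup (Perm (Fin 3 × V))}
    (hr : rotateFlip V ∈ G) (hs : ∀ v, signedTranslate v ∈ G) :
    IsPreprimitive G (Fin 3 × V) := by
  have h3 := G.pow_mem hr 3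
  have h4 := G.pow_mem hr 4
  have hfib (B : Set (Fin 3 × V)) (h0 : (0, 0) ∈ B)
      (hB : ∀ p ∈ B, (rotateFlip V ^ 4) p ∈ B) (a : Fin 3) : (a, 0) ∈ B := by
    have h1 := hB _ h0
    have h2 := hB _ h1
    simp only [rotateFlip_pow_four_apply, if_true] at h1 h2
    fin_cases a
    · exact h0
    · exact h1
    · exact h2
  have : IsPretransitive G (Fin 3 × V) := by
    refine (isPretransitive_iff_base (0, 0)).2 ?_
    rintro ⟨a, v⟩
    have ha := hfib (orbit G (0, 0)) (mem_orbit_self _)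
      (fun p hp ↦ (mem_orbit_of_mem_orbit (⟨_, h4⟩ : G) hp :)) a
    have hv := mem_orbit_of_mem_orbit
      (⟨_, hs (if a = 2 then -v else v)⟩ : G) ha
    have h : signedTranslate (if a = 2 then -v else v) (a, 0) = (a, v) := by
      rw [signedTranslate_apply]
      split_ifs <;> simp
    rw [← h]
    exact hv
  refine IsPreprimitive.of_isTrivialBlock_base (0, 0) fun {B} h0 hB ↦ ?_
  have hmaps {g : Perm (Fin 3 × V)} (hg : g ∈ G) {p : Fin 3 × V} (hp : p ∈ B) (hgp : g p ∈ B)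
      {q : Fin 3 × V} (hq : q ∈ B) : g q ∈ B := by
    have h := hB.smul_eq_of_mem (g := (⟨g, hg⟩ : G)) hp hgp
    rw [← h]
    exact ⟨q, hq, rfl⟩
  refine or_iff_not_imp_left.2 fun hsub ↦ ?_
  have hrot : ∀ p ∈ B, (rotateFlip V ^ 4) p ∈ B := by
    obtain ⟨⟨a, v⟩, hp, hne⟩ : ∃ p ∈ B, p ≠ (0, 0) := by
      by_contra! h
      exact hsub fun p hp q hq ↦ (h p hp).trans (h q hq).symm
    have key : ∃ p ∈ B, (rotateFlip V ^ 4) p ∈ B := by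
      by_cases hv : v = 0
      · subst hv
        fin_cases a
        · exact absurd rfl hne
        · exact ⟨_, h0, by rw [rotateFlip_pow_four_apply, if_pos rfl]; exact hp⟩
        · exact ⟨_, hp, by rw [rotateFlip_pow_four_apply, if_pos rfl]; exact h0⟩
      · exact ⟨_, hp, by rw [rotateFlip_pow_four_apply, if_neg hv]; exact hp⟩
    obtain ⟨p, hp, hp'⟩ := key
    exact fun q hq ↦ hmaps h4 hp hp' hq
  have hB0 := hfib B h0 hrot
  have hmem (v : V) : (0, v) ∈ B ∧ (2, v) ∈ B := by
    by_cases hv : v = 0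
    · subst hv
      exact ⟨hB0 0, hB0 2⟩
    let k (v : V) := signedTranslate (-v) * rotateFlip V ^ 3 * signedTranslate v
    have hk (v : V) : k v ∈ G := G.mul_mem (G.mul_mem (hs _) h3) (hs _)
    have hk0 {v : V} (hv : v ≠ 0) : k v (0, 0) = (2, -v) := by
      simp [k, Perm.mul_apply, signedTranslate_apply, rotateFlip_pow_three_apply, hv, hV]
    have hk1 {v : V} (hv : v ≠ 0) : k v (1, 0) = (1, 0) := by
      simp [k, Perm.mul_apply, signedTranslate_apply, rotateFlip_pow_three_apply, hv,
        swap_apply_def]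
    have hk2 {v : V} (hv : v ≠ 0) : k v (2, 0) = (0, v) := by
      simp [k, Perm.mul_apply, signedTranslate_apply, rotateFlip_pow_three_apply, hv, hV]
    have hkB {v : V} (hv : v ≠ 0) {q : Fin 3 × V} (hq : q ∈ B) : k v q ∈ B :=
      hmaps (hk v) (hB0 1) (by rw [hk1 hv]; exact hB0 1) hq
    refine ⟨hk2 hv ▸ hkB hv (hB0 2), ?_⟩
    have hv' : -v ≠ 0 := neg_ne_zero.2 hv
    have := hkB hv' (hB0 0)
    rwa [hk0 hv', neg_neg] at this
  refine Set.eq_univ_of_forall ?_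
  rintro ⟨a, v⟩
  fin_cases a
  · exact (hmem v).1
  · have h := hmaps (hs v) (hB0 0)
      (by simpa [signedTranslate_apply] using (hmem v).1) (hB0 1)
    simpa [signedTranslate_apply] using h
  · exact (hmem v).2

variable [Fintype V]

theorem sign_rotateFlip (hV : Odd (Fintype.card V)) : sign (rotateFlip V) = 1 := by
  have h3 : sign (finRotate 3) = 1 := by decide
  have h2 : sign (swap (0 : Fin 3) 2) = -1 := by decide
  have he : Even (Finset.univ.filter fun v : V ↦ ¬ v = 0).card := by
    rw [Finset.filter_not, Finset.filter_eq', if_pos (Finset.mem_univ _),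
      Finset.card_sdiff_of_subset (Finset.subset_univ _), Finset.card_univ,
      Finset.card_singleton]
    exact hV.tsub_odd odd_one
  simp only [rotateFlip, sign_prodCongrLeft, apply_ite sign, h3, h2]
  rw [Finset.prod_ite, Finset.prod_const_one, one_mul, Finset.prod_const, he.neg_one_pow]

theorem sign_signedTranslate (hV : ∀ v : V, v + v = -v) (v : V) :
    sign (signedTranslate v) = 1 := by
  have h : signedTranslate v * signedTranslate v = (signedTranslate v)⁻¹ := by
    rw [← signedTranslate_add, hV, signedTranslate_neg]
  have := congrArg sign h
  rwa [Perm.sign_mul, Int.units_mul_self, sign_inv, eq_comm] at this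

theorem closure_eq_alternatingGroup (hV : ∀ v : V, v + v = -v) (hodd : Odd (Fintype.card V))
    {S : Set V} (hS : AddSubgroup.closure S = ⊤) :
    Subgroup.closure (insert (rotateFlip V) (signedTranslate '' S)) =
      alternatingGroup (Fin 3 × V) := by
  have hr : rotateFlip V ∈ Subgroup.closure (insert (rotateFlip V) (signedTranslate '' S)) :=
    Subgroup.subset_closure (Set.mem_insert _ _)
  refine le_antisymm ((Subgroup.closure_le _).2 ?_) ?_
  · rintro g (rfl | ⟨v, -, rfl⟩)
    · exact mem_alternatingGroup.2 (sign_rotateFlip hodd)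
    · exact mem_alternatingGroup.2 (sign_signedTranslate hV v)
  · refine alternatingGroup_le_of_isPreprimitive_of_isThreeCycle_mem
      (isPreprimitive_of_mem hV hr (signedTranslate_mem hS fun v hv ↦
        Subgroup.subset_closure (Set.mem_insert_of_mem _ ⟨v, hv, rfl⟩)))
      (g := rotateFlip V ^ 4) ?_ (Subgroup.pow_mem _ hr 4)
    rw [rotateFlip_pow_four]
    exact isThreeCycle_swap_mul_swap_same (by simp) (by simp) (by simp)

end Pairs

theorem map_permCongrHom_alternatingGroup {α β : Type*} [Fintype α] [DecidableEq α] [Fintype β]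
    [DecidableEq β] (e : α ≃ β) :
    (alternatingGroup α).map e.permCongrHom.toMonoidHom = alternatingGroup β := by
  ext g
  rw [Subgroup.mem_map_equiv, mem_alternatingGroup, mem_alternatingGroup]
  exact Iff.of_eq (congrArg (· = 1) (sign_permCongr e.symm g))

theorem closure_range_single_one (m : ℕ) :
    AddSubgroup.closure (Set.range fun j : Fin m ↦ (Pi.single j 1 : Fin m → Fin 3)) = ⊤ := by
  refine eq_top_iff.2 fun v _ ↦ ?_
  rw [← Finset.univ_sum_single v]
  refine AddSubgroup.sum_mem _ fun j _ ↦ ?_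
  have h : (Pi.single j (v j) : Fin m → Fin 3) = (v j : ℕ) • Pi.single j 1 := by
    rw [← Pi.single_smul]
    congr 1
    generalize v j = a
    revert a
    decide
  rw [h]
  exact AddSubgroup.nsmul_mem _ (AddSubgroup.subset_closure (Set.mem_range_self j)) _

/-- The instruction updating register `j`: `rotateFlip` for the first register and
`signedTranslate` along the corresponding basis vector for the others. -/
def ternaryInstruction (m : ℕ) (j : Fin (m + 1)) : Perm (Fin (m + 1) → Fin 3) :=
  (Fin.consEquiv fun _ ↦ Fin 3).permCongr <|
    Fin.cons (α := fun _ ↦ Perm (Fin 3 × (Fin m → Fin 3))) (rotateFlip (Fin m → Fin 3))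
      (fun i ↦ signedTranslate (Pi.single i 1)) j

theorem ternaryInstruction_zero_apply (m : ℕ) (x : Fin (m + 1) → Fin 3) :
    ternaryInstruction m 0 x =
      Fin.cons ((if Fin.tail x = 0 then finRotate 3 else swap 0 2) (x 0)) (Fin.tail x) := rfl

theorem ternaryInstruction_succ_apply (m : ℕ) (j : Fin m) (x : Fin (m + 1) → Fin 3) :
    ternaryInstruction m j.succ x =
      Fin.cons (x 0) (Fin.tail x + if x 0 = 2 then -Pi.single j 1 else Pi.single j 1) := rfl

theorem isInstruction_ternaryInstruction (m : ℕ) (j : Fin (m + 1)) :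
    IsInstruction (ternaryInstruction m j) := by
  refine ⟨j, fun x i hij ↦ ?_⟩
  cases j using Fin.cases with
  | zero =>
    obtain ⟨i, rfl⟩ := Fin.exists_succ_eq.2 hij
    rw [ternaryInstruction_zero_apply, Fin.cons_succ, Fin.tail]
  | succ j =>
    rw [ternaryInstruction_succ_apply]
    cases i using Fin.cases with
    | zero => rfl
    | succ i =>
      have hij : i ≠ j := fun h ↦ hij (congrArg Fin.succ h)
      split_ifs <;> simp [Fin.tail, hij]

theorem ternaryInstruction_apply_zero (m : ℕ) (j : Fin (m + 1)) :
    ternaryInstruction m j 0 = Pi.single j 1 := by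
  ext1 i
  cases j using Fin.cases with
  | zero =>
    have h : Fin.tail (0 : Fin (m + 1) → Fin 3) = 0 := rfl
    rw [ternaryInstruction_zero_apply, if_pos h, h]
    cases i using Fin.cases with
    | zero => simp
    | succ i => simp
  | succ j =>
    rw [ternaryInstruction_succ_apply]
    cases i using Fin.cases with
    | zero => simp
    | succ i => simp [Fin.tail, Pi.single_apply]

theorem ternaryInstruction_injective (m : ℕ) : Function.Injective (ternaryInstruction m) := by
  intro i j h
  have h := congrFun (congrArg (fun g : Perm (Fin (m + 1) → Fin 3) ↦ g 0) h) j
  simp only [ternaryInstruction_apply_zero, Pi.single_eq_same] at h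
  by_contra hij
  rw [Pi.single_eq_of_ne (Ne.symm hij)] at h
  exact absurd h (by decide)

theorem closure_range_ternaryInstruction (m : ℕ) :
    Subgroup.closure (Set.range (ternaryInstruction m)) =
      alternatingGroup (Fin (m + 1) → Fin 3) := by
  have hV (v : Fin m → Fin 3) : v + v = -v := by
    ext1 i
    rw [Pi.add_apply, Pi.neg_apply]
    generalize v i = a
    revert a
    decide
  have hodd : Odd (Fintype.card (Fin m → Fin 3)) := by
    rw [Fintype.card_fun, Fintype.card_fin, Fintype.card_fin]
    exact Odd.pow (by decide)
  have hrange : Set.range (ternaryInstruction m) =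
      (Fin.consEquiv fun _ : Fin (m + 1) ↦ Fin 3).permCongrHom.toMonoidHom ''
        insert (rotateFlip (Fin m → Fin 3))
          (signedTranslate '' Set.range fun j : Fin m ↦ (Pi.single j 1 : Fin m → Fin 3)) := by
    rw [← Set.range_comp, ← Fin.range_cons, ← Set.range_comp]
    rfl
  rw [hrange, ← MonoidHom.map_closure,
    closure_eq_alternatingGroup hV hodd (closure_range_single_one m),
    map_permCongrHom_alternatingGroup]

/-- The alternating group `Alt({0,1,2}^n)` is generated by `n` instructions. -/
theorem alternating_ternary_generated_by_n_instructions
    (n : ℕ) (hn : 2 ≤ n) :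
    ∃ X : Finset (Equiv.Perm (Fin n → Fin 3)),
      X.card = n ∧ (∀ g ∈ X, IsInstruction g) ∧
      Subgroup.closure (X : Set (Equiv.Perm (Fin n → Fin 3))) =
        alternatingGroup (Fin n → Fin 3) := by
  obtain ⟨m, rfl⟩ : ∃ m, n = m + 1 := ⟨n - 1, by omega⟩
  refine ⟨Finset.univ.map ⟨ternaryInstruction m, ternaryInstruction_injective m⟩, ?_, ?_, ?_⟩
  · simp
  · simp [isInstruction_ternaryInstruction]
  · simpa using closure_range_ternaryInstruction m
end

section
/- For every n ≥ 3, there exists a set of n instructions on {0,1}^n that generates the full symmetric group Sym({0,1}^n). -/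
/-- `Fires j x` says that the `j`-th generator flips register `j` in state `x`. Off register `j`,
the `0`-th generator flips only the zero state; the others flip every state but one, which is the
zero state for `j = 1` and the indicator of register `0` for `j ≥ 2`. -/
def Fires {m : ℕ} (j : Fin (m + 3)) (x : Fin (m + 3) → Fin 2) : Prop :=
  j = 0 ↔ ∀ i, i ≠ j → x i = if i = 0 ∧ j ≠ 1 then 1 else 0

theorem fires_update {m : ℕ} (j : Fin (m + 3)) (x : Fin (m + 3) → Fin 2) (c : Fin 2) :
    Fires j (Function.update x j c) ↔ Fires j x := by
  unfold Fires
  refine iff_congr Iff.rfl (forall_congr' fun i => forall_congr' fun hi => ?_)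
  rw [Function.update_of_ne hi]

open Classical in
/-- Flip register `j` in the states where the `j`-th generator fires. -/
noncomputable def conditionalFlip {m : ℕ} (j : Fin (m + 3)) (x : Fin (m + 3) → Fin 2) :
    Fin (m + 3) → Fin 2 :=
  if Fires j x then Function.update x j (x j + 1) else x

theorem conditionalFlip_of_fires {m : ℕ} {j : Fin (m + 3)} {x : Fin (m + 3) → Fin 2}
    (h : Fires j x) : conditionalFlip j x = Function.update x j (x j + 1) :=
  if_pos h

theorem conditionalFlip_of_not_fires {m : ℕ} {j : Fin (m + 3)} {x : Fin (m + 3) → Fin 2}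
    (h : ¬ Fires j x) : conditionalFlip j x = x :=
  if_neg h

theorem conditionalFlip_involutive {m : ℕ} (j : Fin (m + 3)) :
    Function.Involutive (conditionalFlip j) := by
  intro x
  by_cases h : Fires j x
  · have two : ∀ a : Fin 2, a + 1 + 1 = a := by decide
    rw [conditionalFlip_of_fires h, conditionalFlip_of_fires ((fires_update j x _).2 h)]
    simp [two]
  · rw [conditionalFlip_of_not_fires h, conditionalFlip_of_not_fires h]

/-- The `j`-th generator, as a permutation. -/
noncomputable def flipPerm {m : ℕ} (j : Fin (m + 3)) : Equiv.Perm (Fin (m + 3) → Fin 2) :=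
  (conditionalFlip_involutive j).toPerm

theorem flipPerm_apply {m : ℕ} (j : Fin (m + 3)) (x : Fin (m + 3) → Fin 2) :
    flipPerm j x = conditionalFlip j x :=
  rfl

theorem flipPerm_apply_of_ne {m : ℕ} {i j : Fin (m + 3)} (x : Fin (m + 3) → Fin 2) (h : i ≠ j) :
    flipPerm j x i = x i := by
  rw [flipPerm_apply]
  by_cases hf : Fires j x
  · rw [conditionalFlip_of_fires hf, Function.update_of_ne h]
  · rw [conditionalFlip_of_not_fires hf]

theorem isInstruction_flipPerm {m : ℕ} (j : Fin (m + 3)) : IsInstruction (flipPerm j) :=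
  ⟨j, fun x _ h => flipPerm_apply_of_ne x h⟩

theorem fires_zero_zero {m : ℕ} : Fires (0 : Fin (m + 3)) 0 := by
  simp +contextual [Fires]

theorem not_fires_one_zero {m : ℕ} : ¬ Fires (1 : Fin (m + 3)) 0 := by
  simp [Fires]

/-- A generator updating a register other than `0` and `1` fires if `x 0 = 0` or `x 1 = 1`. -/
theorem fires_of_eq {m : ℕ} {j : Fin (m + 3)} {x : Fin (m + 3) → Fin 2} (h0 : j ≠ 0) (h1 : j ≠ 1)
    (h : x 0 = 0 ∨ x 1 = 1) : Fires j x := by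
  simp only [Fires, h0, false_iff]
  intro hx
  have hx0 := hx 0 h0.symm
  have hx1 := hx 1 h1.symm
  rcases h with h | h <;> simp_all

theorem fires_one {m : ℕ} {i : Fin (m + 3)} {x : Fin (m + 3) → Fin 2} (hi : i ≠ 1)
    (h : x i = 1) : Fires 1 x := by
  simp only [Fires, one_ne_zero, false_iff]
  intro hx
  simpa [h] using hx i hi

theorem exists_fires {m : ℕ} (j : Fin (m + 3)) : ∃ x, Fires j x := by
  by_cases h0 : j = 0
  · exact ⟨0, h0 ▸ fires_zero_zero⟩
  by_cases h1 : j = 1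
  · exact ⟨1, h1 ▸ fires_one (i := 0) (by simp) rfl⟩
  · exact ⟨0, fires_of_eq h0 h1 (Or.inl rfl)⟩

theorem flipPerm_injective {m : ℕ} :
    Function.Injective (flipPerm : Fin (m + 3) → Equiv.Perm (Fin (m + 3) → Fin 2)) := by
  intro j k hjk
  by_contra hne
  obtain ⟨x, hx⟩ := exists_fires j
  have h := flipPerm_apply_of_ne x hne
  rw [← hjk, flipPerm_apply, conditionalFlip_of_fires hx, Function.update_self] at h
  simp at h

/-- The generators act transitively: a set of states that contains `0` and is stable under them
is everything. -/
theorem forall_of_flipPerm_stable {m : ℕ} {C : (Fin (m + 3) → Fin 2) → Prop} (zero : C 0)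
    (stable : ∀ j x, C x → C (flipPerm j x)) (x : Fin (m + 3) → Fin 2) : C x := by
  have step : ∀ {j x c}, Fires j x → c = x j + 1 → C (Function.update x j c) → C x := by
    intro j x c hf hc h
    have := stable j _ h
    rwa [hc, ← conditionalFlip_of_fires hf, flipPerm_apply, conditionalFlip_involutive j x] at this
  have val : ∀ a : Fin 2, a ≠ 0 → a = 1 := by decide
  have raise : ∀ x : Fin (m + 3) → Fin 2, x 0 = 0 ∨ x 1 = 1 →
      C (fun i => if i = 0 ∨ i = 1 then x i else 0) → C x := by
    intro x hx hbase
    have key : ∀ T : Finset (Fin (m + 3)),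
        C (fun i => if (i = 0 ∨ i = 1) ∨ i ∈ T then x i else 0) := by
      intro T
      induction T using Finset.induction_on with
      | empty => simpa using hbase
      | insert j T hj ih =>
        by_cases htriv : (j = 0 ∨ j = 1) ∨ x j = 0
        · convert ih using 1
          ext1 i
          by_cases hi : i = j
          · subst hi
            rcases htriv with h | h <;> simp [h]
          · simp [hi]
        · push Not at htriv
          obtain ⟨⟨h0, h1⟩, hxj⟩ := htriv
          refine step (j := j) (c := 0) (fires_of_eq h0 h1 (by simpa using hx)) ?_ ?_
          · simp [val _ hxj]
          · convert ih using 1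
            ext i
            by_cases hi : i = j
            · subst hi; simp [h0, h1, hj]
            · simp [hi]
    simpa using key Finset.univ
  have low : ∀ x : Fin (m + 3) → Fin 2, x 0 = 0 → x 1 = 0 → C x := by
    intro x h0 h1
    refine raise x (Or.inl h0) ?_
    convert zero using 1
    ext1 i
    by_cases hi0 : i = 0
    · simp [hi0, h0]
    by_cases hi1 : i = 1
    · simp [hi1, h1]
    · simp [hi0, hi1]
  have unit : C (Function.update 0 0 1) := by
    refine step (j := 0) (c := 0) ((fires_update _ _ _).2 fires_zero_zero) (by simp) ?_
    convert zero using 1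
    simp
  have high : ∀ x : Fin (m + 3) → Fin 2, x 0 = 1 → x 1 = 1 → C x := by
    intro x h0 h1
    refine raise x (Or.inr h1) ?_
    refine step (j := 1) (c := 0) (fires_one (i := 0) (by simp) (by simpa using h0)) ?_ ?_
    · simp [h1]
    · convert unit using 1
      ext1 i
      by_cases hi1 : i = 1
      · simp [hi1]
      by_cases hi0 : i = 0
      · simp [hi0, h0]
      · simp [hi0, hi1]
  have mixed : ∀ x : Fin (m + 3) → Fin 2, x 0 = 0 → x 1 = 1 → ∀ i, i ≠ 1 → x i = 1 → C x := by
    intro x h0 h1 i hi hxi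
    exact step (j := 1) (c := 0) (fires_one hi hxi) (by simp [h1])
      (low _ (by simpa using h0) (by simp))
  by_cases h0 : x 0 = 0 <;> by_cases h1 : x 1 = 0
  · exact low x h0 h1
  · have two0 : (2 : Fin (m + 3)) ≠ 0 := by
      simp [Fin.ext_iff, Nat.mod_eq_of_lt (show 2 < m + 3 by omega)]
    have two1 : (2 : Fin (m + 3)) ≠ 1 := by
      simp [Fin.ext_iff, Nat.mod_eq_of_lt (show 2 < m + 3 by omega)]
    by_cases h2 : x 2 = 0
    · refine step (j := 2) (c := 1) (fires_of_eq two0 two1 (Or.inl h0)) (by simp [h2]) ?_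
      exact mixed _ (by simpa [two0.symm] using h0) (by simpa [two1.symm] using val _ h1) 2 two1
        (by simp)
    · exact mixed x h0 (val _ h1) 2 two1 (val _ h2)
  · exact step (j := 1) (c := 1) (fires_one (i := 0) (by simp) (val _ h0)) (by simp [h1])
      (high _ (by simpa using val _ h0) (by simp))
  · exact high x (val _ h0) (val _ h1)

theorem flipPerm_zero {m : ℕ} :
    flipPerm (0 : Fin (m + 3)) = Equiv.swap 0 (Function.update (0 : Fin (m + 3) → Fin 2) 0 1) := by
  ext1 x
  rw [flipPerm_apply]
  by_cases hf : Fires 0 x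
  · have hx : ∀ i, i ≠ 0 → x i = 0 := by simpa +contextual [Fires] using hf
    have bit : x 0 = 0 ∨ x 0 = 1 := by omega
    rw [conditionalFlip_of_fires hf]
    rcases bit with h | h
    · obtain rfl : x = 0 := by
        ext i
        by_cases hi : i = 0 <;> simp_all
      simp
    · obtain rfl : x = Function.update (0 : Fin (m + 3) → Fin 2) 0 1 := by
        ext i
        by_cases hi : i = 0 <;> simp_all
      simp
  · rw [conditionalFlip_of_not_fires hf, Equiv.swap_apply_of_ne_of_ne]
    · rintro rfl
      exact hf fires_zero_zero
    · rintro rfl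
      exact hf ((fires_update _ _ _).2 fires_zero_zero)

theorem closure_range_flipPerm {m : ℕ} :
    Subgroup.closure (Set.range (flipPerm (m := m))) = ⊤ := by
  set G := Subgroup.closure (Set.range (flipPerm (m := m)))
  have mem : ∀ j, flipPerm j ∈ G := fun j => Subgroup.subset_closure ⟨j, rfl⟩
  have conj : ∀ j x y, Equiv.swap x y ∈ G → Equiv.swap (flipPerm j x) (flipPerm j y) ∈ G := by
    intro j x y h
    rw [Equiv.swap_apply_apply]
    exact G.mul_mem (G.mul_mem (mem j) h) (G.inv_mem (mem j))
  have trans : ∀ x y z, Equiv.swap x y ∈ G → Equiv.swap y z ∈ G → Equiv.swap x z ∈ G :=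
    fun _ _ _ => SubmonoidClass.swap_mem_trans G
  have unit : Equiv.swap 0 (Function.update (0 : Fin (m + 3) → Fin 2) 0 1) ∈ G :=
    flipPerm_zero (m := m) ▸ mem 0
  have image_zero : ∀ j, Equiv.swap 0 (flipPerm j 0) ∈ G := by
    intro j
    by_cases h0 : j = 0
    · subst h0
      simpa [flipPerm_zero] using unit
    by_cases h1 : j = 1
    · subst h1
      rw [flipPerm_apply, conditionalFlip_of_not_fires not_fires_one_zero, Equiv.swap_self]
      exact G.one_mem
    · have fixed : flipPerm j (Function.update 0 0 1) =
          Function.update (0 : Fin (m + 3) → Fin 2) 0 1 := by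
        refine conditionalFlip_of_not_fires fun hf => ?_
        simp only [Fires, h0, false_iff] at hf
        apply hf
        intro i _
        simp [Function.update_apply, h1]
      have h := conj j _ _ unit
      rw [fixed, Equiv.swap_comm] at h
      exact trans _ _ _ unit h
  have from_zero : ∀ x, Equiv.swap 0 x ∈ G :=
    forall_of_flipPerm_stable (by rw [Equiv.swap_self]; exact G.one_mem)
      fun j x h => trans _ _ _ (image_zero j) (conj j _ _ h)
  rw [eq_top_iff, ← Equiv.Perm.closure_isSwap, Subgroup.closure_le]
  rintro _ ⟨x, y, _, rfl⟩
  exact trans _ _ _ (Equiv.swap_comm 0 x ▸ from_zero x) (from_zero y)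

/-- The symmetric group `Sym({0,1}^n)` is generated by `n` instructions. -/
theorem symmetric_binary_generated_by_n_instructions
    (n : ℕ) (hn : 3 ≤ n) :
    ∃ X : Finset (Equiv.Perm (Fin n → Fin 2)),
      X.card = n ∧ (∀ g ∈ X, IsInstruction g) ∧
      Subgroup.closure (X : Set (Equiv.Perm (Fin n → Fin 2))) = ⊤ := by
  obtain ⟨m, rfl⟩ := Nat.exists_eq_add_of_le' hn
  refine ⟨Finset.univ.map ⟨flipPerm, flipPerm_injective⟩, by simp, ?_, ?_⟩
  · simpa using isInstruction_flipPerm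
  · simpa using closure_range_flipPerm
end

section
/- If q > 2 is odd and n ≥ 2, then there exists a set of n instructions on A^n that generates the full symmetric group Sym(A^n). -/
namespace RegisterInstruction

variable {ι A : Type*} [DecidableEq ι]

/-- Update coordinate `i` by a permutation of `A` that depends on the other coordinates only. -/
def update (i : ι) (π : (ι → A) → Equiv.Perm A)
    (hπ : ∀ x a, π (Function.update x i a) = π x) : Equiv.Perm (ι → A) where
  toFun x := Function.update x i (π x (x i))
  invFun x := Function.update x i ((π x)⁻¹ (x i))
  left_inv x := by simp [hπ]
  right_inv x := by simp [hπ]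

section

variable {i : ι} {π : (ι → A) → Equiv.Perm A} {hπ : ∀ x a, π (Function.update x i a) = π x}

theorem update_apply (x : ι → A) : update i π hπ x = Function.update x i (π x (x i)) := rfl

theorem update_pow_apply (k : ℕ) (x : ι → A) :
    (update i π hπ ^ k) x = Function.update x i ((π x ^ k) (x i)) := by
  induction k with
  | zero => simp
  | succ k ih => simp [pow_succ', ih, update_apply, hπ]

end

variable [DecidableEq A]

open Classical in
/-- The permutation applied to coordinate `i` of the state `x`. Coordinate `i₀` is moved by `σ`,
except that the transposition `(a, σ a)` is used when all other coordinates equal `a`; the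
other coordinates are moved by `σ` unless `x i₀ = a`. -/
noncomputable def rule (σ : Equiv.Perm A) (a : A) (i₀ i : ι) (x : ι → A) : Equiv.Perm A :=
  if i = i₀ then (if ∀ j, j ≠ i₀ → x j = a then Equiv.swap a (σ a) else σ)
  else if x i₀ = a then 1 else σ

variable {σ : Equiv.Perm A} {a : A} {i₀ : ι}

theorem rule_update (i : ι) (x : ι → A) (b : A) :
    rule σ a i₀ i (Function.update x i b) = rule σ a i₀ i x := by
  unfold rule
  by_cases h : i = i₀
  · subst h
    have : (∀ j, j ≠ i → Function.update x i b j = a) ↔ ∀ j, j ≠ i → x j = a :=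
      forall₂_congr fun j hj => by rw [Function.update_of_ne hj]
    simp only [if_true]
    congr 1
    exact propext this
  · simp [h, Function.update_of_ne (Ne.symm h)]

theorem rule_self_of_forall {x : ι → A} (h : ∀ j, j ≠ i₀ → x j = a) :
    rule σ a i₀ i₀ x = Equiv.swap a (σ a) := by
  simp only [rule, if_true]
  exact if_pos h

theorem rule_self_of_exists {x : ι → A} (h : ∃ j, j ≠ i₀ ∧ x j ≠ a) :
    rule σ a i₀ i₀ x = σ := by
  simp only [rule, if_true]
  exact if_neg (by push Not; exact h)

theorem rule_of_eq {i : ι} (hi : i ≠ i₀) {x : ι → A} (h : x i₀ = a) :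
    rule σ a i₀ i x = 1 := by simp [rule, hi, h]

theorem rule_of_ne {i : ι} (hi : i ≠ i₀) {x : ι → A} (h : x i₀ ≠ a) :
    rule σ a i₀ i x = σ := by simp [rule, hi, h]

variable (σ a i₀) in
/-- The generating instruction for register `i`. -/
noncomputable def gen (i : ι) : Equiv.Perm (ι → A) :=
  update i (rule σ a i₀ i) (rule_update i)

theorem gen_apply (i : ι) (x : ι → A) :
    gen σ a i₀ i x = Function.update x i (rule σ a i₀ i x (x i)) := rfl

theorem gen_pow_apply (i : ι) (k : ℕ) (x : ι → A) :
    (gen σ a i₀ i ^ k) x = Function.update x i ((rule σ a i₀ i x ^ k) (x i)) :=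
  update_pow_apply k x

theorem gen_injective {i₁ : ι} (h₁ : i₁ ≠ i₀) (hσ : ∀ b, σ b ≠ b) :
    Function.Injective (gen σ a i₀) := by
  have key (i : ι) : gen σ a i₀ i (fun _ => σ a) =
      Function.update (fun _ => σ a) i (σ (σ a)) := by
    rw [gen_apply]
    by_cases h : i = i₀
    · subst h
      rw [rule_self_of_exists ⟨i₁, h₁, hσ a⟩]
    · rw [rule_of_ne h (hσ a)]
  intro i j hij
  by_contra hne
  have h := congrFun ((key i).symm.trans ((DFunLike.congr_fun hij _).trans (key j))) i
  rw [Function.update_self, Function.update_of_ne hne] at h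
  exact hσ _ h

variable [Fintype ι]

/-- The transposition extracted from the instruction at `i₀` by an odd power killing `σ`. -/
theorem gen_pow_eq_swap {q : ℕ} (hodd : Odd q) (hpow : σ ^ q = 1) :
    gen σ a i₀ i₀ ^ q =
      Equiv.swap (fun _ => a) (Function.update (fun _ => a) i₀ (σ a)) := by
  ext1 x
  rw [gen_pow_apply]
  by_cases h : ∀ j, j ≠ i₀ → x j = a
  · rw [rule_self_of_forall h]
    have hs : Equiv.swap a (σ a) ^ q = Equiv.swap a (σ a) := by
      obtain ⟨k, rfl⟩ := hodd
      rw [pow_succ, pow_mul, pow_two, Equiv.swap_mul_self, one_pow, one_mul]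
    rw [hs]
    have hx : x = Function.update (fun _ => a) i₀ (x i₀) := by
      ext j
      by_cases hj : j = i₀
      · subst hj; simp
      · simp [hj, h j hj]
    have ha : (fun _ : ι => a) = Function.update (fun _ => a) i₀ a := by simp
    have hinj : Function.Injective fun b : A => Function.update (fun _ : ι => a) i₀ b :=
      Function.update_injective (β := fun _ => A) _ _
    generalize x i₀ = b at hx
    subst hx
    rw [Function.update_idem]
    conv_rhs => rw [ha]; simp only [Function.update_idem]
    exact hinj.map_swap a (σ a) b
  · push Not at h
    obtain ⟨j, hj, hxj⟩ := h
    rw [rule_self_of_exists ⟨j, hj, hxj⟩, hpow, Equiv.Perm.one_apply, Function.update_eq_self,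
      Equiv.swap_apply_of_ne_of_ne]
    · rintro rfl; exact hxj rfl
    · rintro rfl; simp [hj] at hxj

end RegisterInstruction

/-- A subgroup containing all transpositions `(o, x)` is the full symmetric group. -/
theorem Subgroup.eq_top_of_forall_swap_mem {α : Type*} [Finite α] [DecidableEq α]
    (G : Subgroup (Equiv.Perm α)) (o : α) (h : ∀ x, Equiv.swap o x ∈ G) : G = ⊤ := by
  rw [eq_top_iff, ← Equiv.Perm.closure_isSwap, Subgroup.closure_le]
  rintro _ ⟨x, y, -, rfl⟩
  exact SubmonoidClass.swap_mem_trans G (Equiv.swap_comm o x ▸ h x) (h y)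

namespace RegisterInstruction

variable {ι A : Type*} [DecidableEq ι] [Fintype ι] [DecidableEq A] [Finite A]
  {σ : Equiv.Perm A} {a : A} {i₀ : ι}

theorem closure_range_gen {q : ℕ} {i₁ : ι} (h₁ : i₁ ≠ i₀) (hσ : ∀ b, σ b ≠ b)
    (htrans : ∀ b c, ∃ k : ℕ, (σ ^ k) b = c) (hodd : Odd q) (hpow : σ ^ q = 1) :
    Subgroup.closure (Set.range (gen σ a i₀)) = ⊤ := by
  set G := Subgroup.closure (Set.range (gen σ a i₀))
  set o : ι → A := fun _ => a
  have hG (i : ι) : gen σ a i₀ i ∈ G := Subgroup.subset_closure ⟨i, rfl⟩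
  have hbase : Equiv.swap o (Function.update o i₀ (σ a)) ∈ G := by
    rw [← gen_pow_eq_swap hodd hpow]
    exact G.pow_mem (hG i₀) q
  have hconj {g : Equiv.Perm (ι → A)} (hg : g ∈ G) {x y : ι → A} (h : Equiv.swap x y ∈ G) :
      Equiv.swap (g x) (g y) ∈ G := by
    rw [Equiv.swap_apply_apply]
    exact G.mul_mem (G.mul_mem hg h) (G.inv_mem hg)
  have hstep (i : ι) (x : ι → A) (h : Equiv.swap o x ∈ G) :
      Equiv.swap o (gen σ a i₀ i x) ∈ G := by
    have h' := hconj (hG i) h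
    by_cases hi : i = i₀
    · subst hi
      have ho : gen σ a i i o = Function.update o i (σ a) := by
        rw [gen_apply, rule_self_of_forall fun _ _ => rfl, Equiv.swap_apply_left]
      rw [ho] at h'
      exact SubmonoidClass.swap_mem_trans G hbase h'
    · have ho : gen σ a i₀ i o = o := by
        have hr : rule σ a i₀ i o = 1 := rule_of_eq hi rfl
        simp [gen_apply, hr]
      rwa [ho] at h'
  have hsteps (i : ι) (k : ℕ) (x : ι → A) (h : Equiv.swap o x ∈ G) :
      Equiv.swap o ((gen σ a i₀ i ^ k) x) ∈ G := by
    induction k with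
    | zero => simpa using h
    | succ k ih => rw [pow_succ', Equiv.Perm.mul_apply]; exact hstep i _ ih
  have hslice (s : Finset ι) : ∀ x : ι → A, x i₀ = σ a → (∀ i, i ∉ s → i ≠ i₀ → x i = a) →
      Equiv.swap o x ∈ G := by
    induction s using Finset.induction_on with
    | empty =>
      intro x hx h
      have : x = Function.update o i₀ (σ a) := by
        ext j
        by_cases hj : j = i₀
        · subst hj; simpa using hx
        · simp [hj, h j (by simp) hj, o]
      rwa [this]
    | insert j s _ ih =>
      intro x hx h
      by_cases hj : j = i₀
      · exact ih x hx fun i hi hi₀ => h i (by simp [hi, hi₀, hj]) hi₀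
      · obtain ⟨k, hk⟩ := htrans a (x j)
        have hx' : Function.update x j a i₀ = σ a := by
          rw [Function.update_of_ne (Ne.symm hj), hx]
        have := hsteps j k (Function.update x j a) <| ih _ hx' fun i hi hi₀ => by
          by_cases hij : i = j
          · subst hij; simp
          · rw [Function.update_of_ne hij]
            exact h i (by simp [hi, hij]) hi₀
        rw [gen_pow_apply, rule_of_ne hj (hx'.trans_ne (hσ a))] at this
        simpa [hk] using this
  have hoff (x : ι → A) (h : ∃ j, j ≠ i₀ ∧ x j ≠ a) : Equiv.swap o x ∈ G := by
    obtain ⟨k, hk⟩ := htrans (σ a) (x i₀)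
    have := hsteps i₀ k (Function.update x i₀ (σ a)) <|
      hslice Finset.univ _ (by simp) (by simp)
    rw [gen_pow_apply, rule_update, rule_self_of_exists h] at this
    simpa [hk] using this
  refine G.eq_top_of_forall_swap_mem o fun x => ?_
  by_cases h : ∃ j, j ≠ i₀ ∧ x j ≠ a
  · exact hoff x h
  push Not at h
  by_cases hx : x i₀ = a
  · have : x = o := funext fun j => by
      by_cases hj : j = i₀
      · rw [hj, hx]
      · exact h j hj
    rw [this, Equiv.swap_self]
    exact G.one_mem
  · have hne : σ⁻¹ a ≠ a := fun h' => hσ a (by nth_rewrite 1 [← h']; simp)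
    have := hstep i₁ (Function.update x i₁ (σ⁻¹ a)) <|
      hoff _ ⟨i₁, h₁, by simpa using hne⟩
    rw [gen_apply, rule_update, rule_of_ne h₁ hx] at this
    simpa [← h i₁ h₁] using this

end RegisterInstruction

/-- A finite type with `q > 1` elements carries a cyclic permutation of order dividing `q`. -/
theorem exists_perm_transitive_pow_eq_one {A : Type*} [Fintype A] {q : ℕ}
    (hA : Fintype.card A = q) (hq : 1 < q) :
    ∃ σ : Equiv.Perm A, (∀ b, σ b ≠ b) ∧ (∀ b c, ∃ k : ℕ, (σ ^ k) b = c) ∧ σ ^ q = 1 := by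
  have : NeZero q := ⟨by omega⟩
  have : Fact (1 < q) := ⟨hq⟩
  let e : A ≃ ZMod q := Fintype.equivOfCardEq (by rw [hA, ZMod.card])
  let σ : Equiv.Perm A := e.trans ((Equiv.addRight 1).trans e.symm)
  have hpow (k : ℕ) (b : A) : (σ ^ k) b = e.symm (e b + k) := by
    induction k with
    | zero => simp
    | succ k ih => rw [pow_succ', Equiv.Perm.mul_apply, ih]; simp [σ, add_assoc]
  refine ⟨σ, fun b h => ?_, fun b c => ⟨(e c - e b).val, ?_⟩, ?_⟩
  · have := congrArg e h
    simp [σ] at this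
  · simp [hpow]
  · ext b
    simp [hpow]

/-- If `q > 2` is odd, then `Sym(A^n)` is generated by `n` instructions. -/
theorem symmetric_generated_odd_q
    (q n : ℕ) (A : Type*) [Fintype A] [DecidableEq A]
    (hA : Fintype.card A = q) (hq : 2 < q) (hodd : Odd q) (hn : 2 ≤ n) :
    ∃ X : Finset (Equiv.Perm (Fin n → A)),
      X.card = n ∧ (∀ g ∈ X, IsInstruction g) ∧
      Subgroup.closure (X : Set (Equiv.Perm (Fin n → A))) = ⊤ := by
  obtain ⟨σ, hσ, htrans, hpow⟩ := exists_perm_transitive_pow_eq_one hA (by omega)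
  have : Nonempty A := Fintype.card_pos_iff.mp (by omega)
  obtain ⟨a⟩ := this
  let i₀ : Fin n := ⟨0, by omega⟩
  let i₁ : Fin n := ⟨1, by omega⟩
  have h₁ : i₁ ≠ i₀ := by simp [i₀, i₁]
  classical
  refine ⟨Finset.univ.image (RegisterInstruction.gen σ a i₀), ?_, ?_, ?_⟩
  · rw [Finset.card_image_of_injective _ (RegisterInstruction.gen_injective h₁ hσ),
      Finset.card_univ, Fintype.card_fin]
  · intro g hg
    obtain ⟨i, -, rfl⟩ := Finset.mem_image.mp hg
    exact ⟨i, fun x j hj => Function.update_of_ne hj _ _⟩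
  · rw [Finset.coe_image, Finset.coe_univ, Set.image_univ]
    exact RegisterInstruction.closure_range_gen h₁ hσ htrans hodd hpow
end

section
/- If q > 2 is even and n ≥ 2, then there exists a set of n instructions on A^n that generates the full symmetric group Sym(A^n). -/
open Equiv

section

variable {ι A : Type*} [DecidableEq ι]

/-- The permutation of `ι → A` applying to the coordinate `j` a permutation `s x` of `A` that does
not depend on that coordinate. -/
def coordPerm (j : ι) (s : (ι → A) → Perm A)
    (hs : ∀ x v, s (Function.update x j v) = s x) : Perm (ι → A) where
  toFun x := Function.update x j (s x (x j))
  invFun x := Function.update x j ((s x).symm (x j))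
  left_inv x := by simp [hs]
  right_inv x := by simp [hs]

lemma coordPerm_apply (j : ι) (s : (ι → A) → Perm A)
    (hs : ∀ x v, s (Function.update x j v) = s x) (x : ι → A) :
    coordPerm j s hs x = Function.update x j (s x (x j)) := rfl

lemma coordPerm_pow_apply (j : ι) (s : (ι → A) → Perm A)
    (hs : ∀ x v, s (Function.update x j v) = s x) (k : ℕ) (x : ι → A) :
    (coordPerm j s hs ^ k) x = Function.update x j ((s x ^ k) (x j)) := by
  induction k with
  | zero => simp
  | succ k ih => simp [pow_succ', ih, coordPerm_apply, hs]

end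

/-- A subgroup `H` of a symmetric group is everything if it contains all transpositions moving a
given point. -/
lemma eq_top_of_forall_swap_mem {X : Type*} [DecidableEq X] [Finite X] {H : Subgroup (Perm X)}
    (p : X) (h : ∀ x, swap p x ∈ H) : H = ⊤ := by
  rw [eq_top_iff, ← Perm.closure_isSwap, Subgroup.closure_le]
  rintro _ ⟨x, y, -, rfl⟩
  exact SubmonoidClass.swap_mem_trans H (swap_comm p x ▸ h x) (h y)

/-- The set of points joined to `p` by a transposition in a subgroup `H` is stable under every
element of `H` that maps some point `u` of this set into it. -/
lemma swap_apply_mem {X : Type*} [DecidableEq X] {H : Subgroup (Perm X)} {p u x : X} {h : Perm X}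
    (hh : h ∈ H) (hu : swap p u ∈ H) (hhu : swap p (h u) ∈ H) (hx : swap p x ∈ H) :
    swap p (h x) ∈ H := by
  have hux : swap u x ∈ H := SubmonoidClass.swap_mem_trans H (swap_comm p u ▸ hu) hx
  refine SubmonoidClass.swap_mem_trans H hhu ?_
  rw [swap_apply_apply]
  exact H.mul_mem (H.mul_mem hh hux) (H.inv_mem hh)

section

variable {ι A : Type*} [DecidableEq ι] [Fintype ι] [DecidableEq A] [Fintype A]

/-- The hypotheses describe one instruction `g i` per coordinate: `g i₀` exchanges `a` and `b` on
the line through the constant function `a` and acts by `3`-cycles `(a c b)` on the other lines,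
whereas `g j` applies a full cycle `σ` to the lines on which the coordinate `i₀` is not `a`. -/
lemma closure_range_eq_top_of_apply {i₀ i₁ : ι} (hi : i₁ ≠ i₀) {a b : A} (hab : a ≠ b)
    {σ : Perm A} (hσ : ∀ v w, ∃ k : ℕ, (σ ^ k) v = w)
    {f : A → A} (hfa : ∀ v, f v ≠ a) (hfb : ∀ v, f v ≠ b) (hf : ∀ v, v ≠ a → v ≠ b → f v = v)
    {g : ι → Perm (ι → A)}
    (hg : ∀ j, j ≠ i₀ → ∀ (k : ℕ) x, (g j ^ k) x =
      Function.update x j (((if x i₀ = a then 1 else σ) ^ k) (x j)))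
    (hg₀ : ∀ (k : ℕ) x, (g i₀ ^ k) x = Function.update x i₀
      (((if ∀ i, i ≠ i₀ → x i = a then swap a b else swap a b * swap a (f (x i₁))) ^ k) (x i₀))) :
    Subgroup.closure (Set.range g) = ⊤ := by
  set H := Subgroup.closure (Set.range g)
  have hmem : ∀ j, g j ∈ H := fun j ↦ Subgroup.subset_closure ⟨j, rfl⟩
  set p : ι → A := fun _ ↦ a with hp
  have hswap : swap p (Function.update p i₀ b) ∈ H := by
    convert H.pow_mem (hmem i₀) 3 using 1
    ext1 x
    rw [hg₀]
    split_ifs with hx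
    · have hx' : x = Function.update p i₀ (x i₀) := by
        ext i
        by_cases h : i = i₀
        · subst h; simp
        · simp [h, hx i h, hp]
      have h3 : swap a b ^ 3 = swap a b := by simp [pow_succ]
      rw [h3]
      generalize x i₀ = v at hx'
      subst hx'
      have hpa : Function.update p i₀ a = p := by simp [hp]
      by_cases hva : v = a
      · subst hva
        simp [hpa]
      by_cases hvb : v = b
      · subst hvb
        simp [hpa]
      rw [swap_apply_of_ne_of_ne hva hvb, swap_apply_of_ne_of_ne]
      · simp
      · intro h
        exact hva (by simpa [hp] using congrFun h i₀)
      · intro h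
        exact hvb (by simpa [hp] using congrFun h i₀)
    · have h3 : (swap a b * swap a (f (x i₁))) ^ 3 = 1 := by
        have := (Perm.isThreeCycle_swap_mul_swap_same hab (hfa (x i₁)).symm
          (hfb (x i₁)).symm).orderOf
        rw [← this, pow_orderOf_eq_one]
      rw [h3, swap_apply_of_ne_of_ne]
      · simp
      · rintro rfl
        exact hx fun i _ ↦ rfl
      · rintro rfl
        exact hx fun i h ↦ by simp [h, hp]
  have hp₁ : swap p p ∈ H := by
    rw [swap_self]
    exact H.one_mem
  have hg_p : ∀ j, swap p (g j p) ∈ H := fun j ↦ by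
    by_cases hj : j = i₀
    · subst hj
      have := hg₀ 1 p
      simp only [pow_one] at this
      rw [this]
      simpa [hp] using hswap
    · have := hg j hj 1 p
      simp only [pow_one] at this
      rw [this]
      simpa [hp] using hp₁
  have hstep : ∀ (j : ι) (k : ℕ) (x), swap p x ∈ H → swap p ((g j ^ k) x) ∈ H := fun j k ↦ by
    induction k with
    | zero => simp
    | succ k ih =>
      intro x hx
      rw [pow_succ', Perm.mul_apply]
      exact swap_apply_mem (hmem j) hp₁ (hg_p j) (ih x hx)
  have hwalk : ∀ x z : ι → A, swap p x ∈ H → x i₀ ≠ a → z i₀ = x i₀ → swap p z ∈ H := by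
    intro x z hx hxa
    have key : ∀ s : Finset ι, i₀ ∉ s → ∀ z : ι → A, (∀ i ∉ s, z i = x i) → swap p z ∈ H := by
      intro s
      induction s using Finset.induction_on with
      | empty =>
        intro _ z hz
        rwa [show z = x from funext fun i ↦ hz i (by simp)]
      | insert j s hj ih =>
        intro hs z hz
        simp only [Finset.mem_insert, not_or] at hs hz
        have hw := ih hs.2 (Function.update z j (x j)) fun i his ↦ by
          by_cases hij : i = j
          · subst hij; simp
          · simp [hij, hz i ⟨hij, his⟩]
        obtain ⟨k, hk⟩ := hσ (x j) (z j)
        have := hstep j k _ hw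
        rw [hg j (Ne.symm hs.1)] at this
        simpa [hs.1, hz i₀ hs, hxa, hk] using this
    intro hz
    exact key (Finset.univ.erase i₀) (by simp) z fun i h ↦ by
      obtain rfl : i = i₀ := by simpa using h
      exact hz
  have hB : ∀ x : ι → A, x i₀ = b → swap p x ∈ H := fun x hx ↦
    hwalk _ x hswap (by simpa using hab.symm) (by simpa using hx)
  have hA : ∀ x : ι → A, x i₀ = a → swap p x ∈ H := by
    intro x hx
    by_cases hxp : ∀ i, i ≠ i₀ → x i = a
    · have : x = p := funext fun i ↦ by
        by_cases h : i = i₀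
        · rw [h, hx]
        · exact hxp i h
      rwa [this]
    · have := hstep i₀ 1 _ (hB (Function.update x i₀ b) (by simp))
      rw [hg₀, if_neg (fun h ↦ hxp fun i hi ↦ by simpa [hi] using h i hi)] at this
      have hb : swap a (f (x i₁)) b = b := swap_apply_of_ne_of_ne hab.symm (hfb _).symm
      have hx' : Function.update x i₀ a = x := by rw [← hx, Function.update_eq_self]
      simpa [hi, hb, hx'] using this
  refine eq_top_of_forall_swap_mem p fun x ↦ ?_
  by_cases hxa : x i₀ = a
  · exact hA x hxa
  by_cases hxb : x i₀ = b
  · exact hB x hxb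
  set v := x i₀ with hv
  have hw := hstep i₀ 1 _ (hA (Function.update (Function.update p i₁ v) i₀ a) (by simp))
  rw [hg₀, if_neg (fun h ↦ hxa (by simpa [hi] using h i₁ hi))] at hw
  simp only [Function.update_idem, pow_one, Function.update_self, Perm.mul_apply, swap_apply_left,
    Function.update_of_ne hi, hf v hxa hxb, swap_apply_of_ne_of_ne hxa hxb] at hw
  exact hwalk _ x hw (by simpa using hxa) (by simp [hv])

end

/-- If `q > 2` is even, then `Sym(A^n)` is generated by `n` instructions. -/
theorem symmetric_generated_even_q
    (q n : ℕ) (A : Type*) [Fintype A] [DecidableEq A]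
    (hA : Fintype.card A = q) (hq : 2 < q) (heven : Even q) (hn : 2 ≤ n) :
    ∃ X : Finset (Equiv.Perm (Fin n → A)),
      X.card = n ∧ (∀ g ∈ X, IsInstruction g) ∧
      Subgroup.closure (X : Set (Equiv.Perm (Fin n → A))) = ⊤ := by
  obtain ⟨a, b, c, hab, hac, hbc⟩ := Fintype.two_lt_card_iff.1 (hA ▸ hq)
  obtain ⟨σ, hσ, -⟩ := (Finset.univ : Finset A).exists_cycleOn
  have hσ' : ∀ v w, ∃ k : ℕ, (σ ^ k) v = w := fun v w ↦ by
    obtain ⟨k, -, hk⟩ := hσ.exists_pow_eq (Finset.mem_univ v) (Finset.mem_univ w)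
    exact ⟨k, hk⟩
  let i₀ : Fin n := ⟨0, by omega⟩
  let i₁ : Fin n := ⟨1, by omega⟩
  have hi : i₁ ≠ i₀ := by simp [i₀, i₁]
  let f : A → A := fun v ↦ if v = a ∨ v = b then c else v
  let s : Fin n → (Fin n → A) → Perm A := fun j x ↦
    if j = i₀ then
      if ∀ i, i ≠ i₀ → x i = a then swap a b else swap a b * swap a (f (x i₁))
    else if x i₀ = a then 1 else σ
  have hs : ∀ j x v, s j (Function.update x j v) = s j x := by
    intro j x v
    by_cases hj : j = i₀
    · subst hj
      have : (∀ i, i ≠ i₀ → Function.update x i₀ v i = a) ↔ ∀ i, i ≠ i₀ → x i = a :=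
        forall₂_congr fun i h ↦ by rw [Function.update_of_ne h]
      simp only [s, if_true, this, Function.update_of_ne hi]
    · simp only [s, if_neg hj, Function.update_of_ne (Ne.symm hj)]
  let g : Fin n → Perm (Fin n → A) := fun j ↦ coordPerm j (s j) (hs j)
  have hinstr : ∀ j x i, i ≠ j → g j x i = x i := fun j x i h ↦ by
    simp only [g, coordPerm_apply, Function.update_of_ne h]
  have hne : ∀ j, ∃ x, g j x j ≠ x j := by
    intro j
    simp only [g, coordPerm_apply, Function.update_self]
    by_cases hj : j = i₀
    · exact ⟨fun _ ↦ a, by simpa [s, hj] using hab.symm⟩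
    · refine ⟨fun _ ↦ b, ?_⟩
      simp only [s, if_neg hj, if_neg hab.symm]
      exact hσ.apply_ne (by simpa [Set.nontrivial_univ_iff] using ⟨a, b, hab⟩)
        (Finset.mem_univ b)
  have hinj : Function.Injective g := by
    intro i j hij
    by_contra h
    obtain ⟨x, hx⟩ := hne i
    exact hx (by rw [hij]; exact hinstr j x i h)
  refine ⟨Finset.univ.image g, ?_, ?_, ?_⟩
  · rw [Finset.card_image_of_injective _ hinj, Finset.card_fin]
  · simp only [Finset.mem_image, Finset.mem_univ, true_and]
    rintro _ ⟨j, rfl⟩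
    exact ⟨j, hinstr j⟩
  · rw [Finset.coe_image, Finset.coe_univ, Set.image_univ]
    refine closure_range_eq_top_of_apply hi hab hσ' (f := f) ?_ ?_ ?_ ?_ ?_
    · intro v
      simp only [f]
      split_ifs with h
      · exact hac.symm
      · exact fun h' ↦ h (Or.inl h')
    · intro v
      simp only [f]
      split_ifs with h
      · exact hbc.symm
      · exact fun h' ↦ h (Or.inr h')
    · intro v ha hb
      simp [f, ha, hb]
    · intro j hj k x
      simp only [g, coordPerm_pow_apply, s, if_neg hj]
    · intro k x
      simp only [g, coordPerm_pow_apply, s, if_true]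
      congr!
end

section
/- If q > 1 with q ≡ 1 or 5 (mod 6) and n ≥ 2, then there exists a set of n instructions on A^n, each of which is an even permutation, that generates the alternating group Alt(A^n). -/
open Equiv Equiv.Perm Function

/-- If the stabilizer of a point is transitive on the other points, and the point is not fixed by
the whole group, then the action is 2-transitive. -/
theorem isMultiplyPretransitive_two_of_point {G X : Type*} [Group G] [MulAction G X] (o : X)
    (hmove : ∃ g : G, g • o ≠ o)
    (htrans : ∀ x y : X, x ≠ o → y ≠ o → ∃ g : G, g • o = o ∧ g • x = y) :
    MulAction.IsMultiplyPretransitive G X 2 := by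
  have to_point : ∀ a : X, ∃ g : G, g • a = o := by
    intro a
    by_cases ha : a = o
    · exact ⟨1, by simpa using ha⟩
    · obtain ⟨h, hh⟩ := hmove
      obtain ⟨k, -, hk⟩ := htrans a (h • o) ha hh
      exact ⟨h⁻¹ * k, by rw [mul_smul, hk, inv_smul_smul]⟩
  rw [MulAction.is_two_pretransitive_iff]
  intro a b c d hab hcd
  obtain ⟨g, hg⟩ := to_point a
  obtain ⟨h, hh⟩ := to_point c
  obtain ⟨k, hko, hk⟩ := htrans (g • b) (h • d)
    (fun e => hab (smul_left_cancel g (hg.trans e.symm)))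
    (fun e => hcd (smul_left_cancel h (hh.trans e.symm)))
  refine ⟨h⁻¹ * k * g, ?_, ?_⟩
  · rw [mul_smul, mul_smul, hg, hko, ← hh, inv_smul_smul]
  · rw [mul_smul, mul_smul, hk, inv_smul_smul]

section AxisPerm

variable {ι A : Type*}

/-- The points whose coordinates other than `j` all equal `z`. -/
def OnAxis (z : A) (j : ι) (x : ι → A) : Prop := ∀ i, i ≠ j → x i = z

theorem onAxis_const (z : A) (j : ι) : OnAxis z j fun _ => z := fun _ _ => rfl

variable [DecidableEq ι]

theorem onAxis_update_iff {z : A} {j : ι} {x : ι → A} {a : A} :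
    OnAxis z j (update x j a) ↔ OnAxis z j x :=
  forall₂_congr fun i hi => by rw [update_of_ne hi]

open Classical in
/-- The permutation acting on coordinate `j` by the first component on the axis through the
constant point `z`, and by the second component on all other lines in direction `j`. -/
noncomputable def axisPerm (z : A) (j : ι) : Perm A × Perm A →* Perm (ι → A) :=
  letI : MulAction (Perm A × Perm A) (ι → A) :=
    { smul p x := update x j ((if OnAxis z j x then p.1 else p.2) (x j))
      one_smul x := by
        change update x j _ = x
        simp
      mul_smul p r x := by
        change update x j _ = update (update x j _) j
          ((if OnAxis z j (update x j _) then p.1 else p.2) (update x j _ j))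
        rw [onAxis_update_iff]
        split_ifs <;> simp }
  MulAction.toPermHom _ _

theorem axisPerm_apply_of_onAxis {z : A} {j : ι} {x : ι → A} (h : OnAxis z j x) (π ρ : Perm A) :
    axisPerm z j (π, ρ) x = update x j (π (x j)) := by
  change update x j _ = _
  rw [if_pos h]

theorem axisPerm_apply_of_not_onAxis {z : A} {j : ι} {x : ι → A} (h : ¬ OnAxis z j x)
    (π ρ : Perm A) : axisPerm z j (π, ρ) x = update x j (ρ (x j)) := by
  change update x j _ = _
  rw [if_neg h]

theorem axisPerm_apply_of_ne (z : A) {i j : ι} (h : i ≠ j) (p : Perm A × Perm A) (x : ι → A) :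
    axisPerm z j p x i = x i :=
  update_of_ne h _ _

theorem axisPerm_const (z : A) (j : ι) (π ρ : Perm A) :
    axisPerm z j (π, ρ) (fun _ => z) = update (fun _ => z) j (π z) :=
  axisPerm_apply_of_onAxis (onAxis_const z j) π ρ

theorem isThreeCycle_axisPerm [Fintype ι] [Fintype A] [DecidableEq A] (z : A) (j : ι)
    {τ : Perm A} (hτ : τ.IsThreeCycle) : (axisPerm z j (τ, 1)).IsThreeCycle := by
  have hsupp : (axisPerm z j (τ, 1)).support =
      τ.support.image fun a => update (fun _ => z) j a := by
    ext x
    simp only [Perm.mem_support, Finset.mem_image]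
    by_cases hx : OnAxis z j x
    · have hxz : update (fun _ => z) j (x j) = x := by
        ext i
        by_cases hi : i = j
        · subst hi; simp
        · simp [hi, hx i hi]
      rw [axisPerm_apply_of_onAxis hx, Ne, update_eq_self_iff]
      constructor
      · exact fun h => ⟨x j, h, hxz⟩
      · rintro ⟨a, ha, rfl⟩
        simpa using ha
    · rw [axisPerm_apply_of_not_onAxis hx]
      simp only [coe_one, id_eq, update_eq_self, ne_eq, not_true_eq_false, false_iff]
      rintro ⟨a, -, rfl⟩
      exact hx (onAxis_update_iff.2 (onAxis_const z j))
  rw [← card_support_eq_three_iff, hsupp,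
    Finset.card_image_of_injective _ (update_injective _ j), card_support_eq_three_iff]
  exact hτ

/-- If every coordinate of a point can be changed arbitrarily as long as another coordinate differs
from `z`, then all points other than the constant point `z` are equivalent. -/
theorem equivalent_of_update [Finite ι] [Nontrivial ι] {z : A}
    {r : (ι → A) → (ι → A) → Prop} (hr : Equivalence r)
    (hupdate : ∀ (j : ι) (x : ι → A) (a : A), ¬ OnAxis z j x → r x (update x j a))
    {x y : ι → A} (hx : x ≠ fun _ => z) (hy : y ≠ fun _ => z) : r x y := by
  classical
  have := Fintype.ofFinite ι
  obtain ⟨k, hk⟩ := Function.ne_iff.1 hx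
  have to_const : ∀ w : ι → A, (w ≠ fun _ => z) → r w fun _ => x k := by
    intro w hw
    obtain ⟨i, hi⟩ := Function.ne_iff.1 hw
    have partial_const : ∀ s : Finset ι, i ∉ s → r w (s.piecewise (fun _ => x k) w) := by
      intro s
      induction s using Finset.induction_on with
      | empty => intro _; simpa using hr.refl w
      | insert j s _ ih =>
        intro his
        rw [Finset.mem_insert, not_or] at his
        rw [Finset.piecewise_insert]
        refine hr.trans (ih his.2) (hupdate j _ _ fun h => hi ?_)
        simpa [his.2] using h i his.1
    have hlast : (fun _ => x k) =
        update ((Finset.univ.erase i).piecewise (fun _ => x k) w) i (x k) := by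
      rw [← Finset.piecewise_insert (f := fun _ => x k), Finset.insert_erase (Finset.mem_univ i),
        Finset.piecewise_univ]
    rw [hlast]
    refine hr.trans (partial_const _ (Finset.notMem_erase i _)) (hupdate i _ _ fun h => hk ?_)
    obtain ⟨l, hl⟩ := exists_ne i
    simpa [hl] using h l hl
  exact hr.trans (to_const x hx) (hr.symm (to_const y hy))

end AxisPerm

/-- A subgroup containing, for each coordinate, a 3-cycle moving `z` on the axis through `z` and a
full cycle on all other parallel lines, contains the alternating group. -/
theorem alternatingGroup_le_of_axisPerm_mem {ι A : Type*} [Fintype ι] [DecidableEq ι] [Nontrivial ι]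
    [Fintype A] [DecidableEq A] {z : A} {σ τ : Perm A} (hσ : σ.IsCycleOn Set.univ)
    (hτ : τ.IsThreeCycle) (hτz : τ z ≠ z) {G : Subgroup (Perm (ι → A))}
    (hGτ : ∀ j, axisPerm z j (τ, 1) ∈ G) (hGσ : ∀ j, axisPerm z j (1, σ) ∈ G) :
    alternatingGroup (ι → A) ≤ G := by
  obtain ⟨k⟩ : Nonempty ι := inferInstance
  refine alternatingGroup_le_of_isPreprimitive_of_isThreeCycle_mem
    (MulAction.isPreprimitive_of_is_two_pretransitive
      (isMultiplyPretransitive_two_of_point (fun _ => z) ?_ ?_))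
    (isThreeCycle_axisPerm z k hτ) (hGτ k)
  · refine ⟨⟨_, hGτ k⟩, fun h => hτz ?_⟩
    change axisPerm z k (τ, 1) _ = _ at h
    rw [axisPerm_const] at h
    simpa using congrFun h k
  · intro x y hx hy
    refine equivalent_of_update (z := z)
      (r := fun x y => ∃ g : G, (g • fun _ => z) = (fun _ => z) ∧ g • x = y)
      ⟨fun x => ⟨1, by simp⟩, ?_, ?_⟩ ?_ hx hy
    · rintro x y ⟨g, hgz, rfl⟩
      exact ⟨g⁻¹, by rw [inv_smul_eq_iff, hgz], inv_smul_smul g x⟩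
    · rintro x y w ⟨g, hgz, rfl⟩ ⟨h, hhz, rfl⟩
      exact ⟨h * g, by rw [mul_smul, hgz, hhz], mul_smul h g x⟩
    · intro j x a hx
      obtain ⟨m, hm⟩ := hσ.2 (Set.mem_univ (x j)) (Set.mem_univ a)
      have hmem : axisPerm z j (1, σ ^ m) ∈ G := by
        simpa [← map_zpow] using G.zpow_mem (hGσ j) m
      refine ⟨⟨_, hmem⟩, ?_, ?_⟩
      · change axisPerm z j (1, σ ^ m) _ = _
        rw [axisPerm_const]
        simp
      · change axisPerm z j (1, σ ^ m) _ = _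
        rw [axisPerm_apply_of_not_onAxis hx, hm]

theorem sign_eq_one_of_odd_pow_eq_one {α : Type*} [Fintype α] [DecidableEq α] {g : Perm α} {m : ℕ}
    (hm : Odd m) (hg : g ^ m = 1) : sign g = 1 := by
  rcases Int.units_eq_one_or (sign g) with h | h
  · exact h
  · have := congrArg sign hg
    rw [map_pow, h, hm.neg_one_pow, map_one] at this
    exact absurd this (by decide)

/-- If `q > 1` and `q ≡ 1` or `5 (mod 6)`, then `Alt(A^n)` is generated by
`n` even instructions. -/
theorem alternating_generated_q_1_5_mod_6
    (q n : ℕ) (A : Type*) [Fintype A] [DecidableEq A]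
    (hA : Fintype.card A = q) (hq : 1 < q)
    (hmod : q % 6 = 1 ∨ q % 6 = 5) (hn : 2 ≤ n) :
    ∃ X : Finset (Equiv.Perm (Fin n → A)),
      X.card = n ∧
      (∀ g ∈ X, IsInstruction g ∧ g ∈ alternatingGroup (Fin n → A)) ∧
      Subgroup.closure (X : Set (Equiv.Perm (Fin n → A))) =
        alternatingGroup (Fin n → A) := by
  have : Nontrivial (Fin n) := Fin.nontrivial_iff_two_le.2 hn
  obtain ⟨z, b, c, hzb, hzc, hbc⟩ := Fintype.two_lt_card_iff.1 (by omega : 2 < Fintype.card A)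
  obtain ⟨σ, hσ, -⟩ := (Set.to_countable (Set.univ : Set A)).exists_cycleOn
  set τ : Perm A := swap z b * swap z c with hτ_def
  have hτ : τ.IsThreeCycle := isThreeCycle_swap_mul_swap_same hzb hzc hbc
  have hτz : τ z ≠ z := by
    simp [hτ_def, swap_apply_of_ne_of_ne hzc.symm hbc.symm, hzc.symm]
  have hσq : σ ^ q = 1 := by
    ext a
    rw [← hA]
    exact IsCycleOn.pow_card_apply (s := Finset.univ) (by simpa using hσ) (Finset.mem_univ a)
  have hτ3 : τ ^ 3 = 1 := hτ.orderOf ▸ pow_orderOf_eq_one τ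
  set g : Fin n → Perm (Fin n → A) := fun j => axisPerm z j (τ, σ) with hg_def
  have hg_inj : Injective g := by
    intro i j hij
    by_contra hne
    have h := congrFun (congrArg (⇑) hij) fun _ => z
    simp only [hg_def, axisPerm_const] at h
    exact hτz (by simpa [hne] using congrFun h i)
  have hg_alt : ∀ j, g j ∈ alternatingGroup (Fin n → A) := by
    intro j
    refine mem_alternatingGroup.2 (sign_eq_one_of_odd_pow_eq_one (m := 3 * q) ?_ ?_)
    · rw [Nat.odd_iff]; omega
    · rw [hg_def, ← map_pow, Prod.pow_mk, pow_mul, hτ3, one_pow, mul_comm, pow_mul, hσq, one_pow]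
      exact map_one _
  refine ⟨Finset.univ.image g, ?_, ?_, le_antisymm ?_ ?_⟩
  · rw [Finset.card_image_of_injective _ hg_inj, Finset.card_fin]
  · intro f hf
    obtain ⟨j, -, rfl⟩ := Finset.mem_image.1 hf
    exact ⟨⟨j, fun x i hi => axisPerm_apply_of_ne z hi _ x⟩, hg_alt j⟩
  · rw [Subgroup.closure_le]
    intro f hf
    obtain ⟨j, -, rfl⟩ := Finset.mem_image.1 (Finset.mem_coe.1 hf)
    exact hg_alt j
  · have hg_mem : ∀ j, g j ∈ Subgroup.closure
        ((Finset.univ.image g : Finset _) : Set (Perm (Fin n → A))) :=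
      fun j => Subgroup.subset_closure (by simp)
    have hcop : Nat.Coprime 3 q := (Nat.Prime.coprime_iff_not_dvd Nat.prime_three).2 (by omega)
    obtain ⟨k, hk3, hkq⟩ := Nat.chineseRemainder hcop 1 0
    have hτk : τ ^ k = τ := by
      conv_rhs => rw [← pow_one τ]
      rwa [pow_eq_pow_iff_modEq, hτ.orderOf]
    have hσk : σ ^ k = 1 := by
      obtain ⟨m, rfl⟩ := (Nat.modEq_zero_iff_dvd).1 hkq
      rw [pow_mul, hσq, one_pow]
    have hGτ : ∀ j, axisPerm z j (τ, 1) ∈ Subgroup.closure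
        ((Finset.univ.image g : Finset _) : Set (Perm (Fin n → A))) := by
      intro j
      have h := Subgroup.pow_mem _ (hg_mem j) k
      rwa [hg_def, ← map_pow, Prod.pow_mk, hτk, hσk] at h
    refine alternatingGroup_le_of_axisPerm_mem hσ hτ hτz hGτ fun j => ?_
    have h := Subgroup.mul_mem _ (Subgroup.inv_mem _ (hGτ j)) (hg_mem j)
    rwa [hg_def, ← map_inv, ← map_mul, Prod.inv_mk, Prod.mk_mul_mk, inv_mul_cancel, inv_one,
      one_mul] at h
end

section
/- If q > 2 with q ≡ 0 or 2 (mod 6) and n ≥ 2, then there exists a set of n instructions on A^n, each of which is an even permutation, that generates the alternating group Alt(A^n). -/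
section helpers

open Equiv Equiv.Perm
open scoped Pointwise

theorem alternatingGroup_le_of_swap_mul_swap_mem_of_congruence {α : Type*} [Fintype α]
    [DecidableEq α] {G : Subgroup (Perm α)} {p a b : α} (hpa : p ≠ a) (hpb : p ≠ b) (hab : a ≠ b)
    (hT : swap p a * swap p b ∈ G)
    (h : ∀ E : α → α → Prop, Equivalence E → (∀ g ∈ G, ∀ x y, E x y → E (g x) (g y)) →
      E p a → ∀ x y, E x y) :
    alternatingGroup α ≤ G := by
  set T := swap p a * swap p b with hTdef
  have Tp : T p = b := by
    simp [T, swap_apply_of_ne_of_ne hpb.symm hab.symm]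
  have Tb : T b = a := by simp [T]
  have Ta : T a = p := by simp [T, swap_apply_of_ne_of_ne hpa.symm hab]
  have Tfix : ∀ z, z ≠ p → z ≠ a → z ≠ b → T z = z := fun z h1 h2 h3 => by
    simp [T, swap_apply_of_ne_of_ne h1 h3, swap_apply_of_ne_of_ne h1 h2]
  have htrans : MulAction.IsPretransitive G α := by
    refine ⟨fun x y => ?_⟩
    obtain ⟨g, hg, rfl⟩ := h (fun x y => ∃ g ∈ G, g x = y) ⟨fun x => ⟨1, one_mem _, rfl⟩,
      fun {x y} ⟨g, hg, hgx⟩ => ⟨g⁻¹, inv_mem hg, by simp [← hgx]⟩,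
      fun {x y z} ⟨g, hg, hgx⟩ ⟨k, hk, hky⟩ => ⟨k * g, mul_mem hk hg, by simp [hgx, hky]⟩⟩
      (fun g hg x y ⟨k, hk, hkx⟩ => ⟨g * k * g⁻¹, mul_mem (mul_mem hg hk) (inv_mem hg),
        by simp [hkx]⟩) ⟨T * T, mul_mem hT hT, by simp [Tp, Tb]⟩ x y
    exact ⟨⟨g, hg⟩, rfl⟩
  refine alternatingGroup_le_of_isPreprimitive_of_isThreeCycle_mem
    { toIsPretransitive := htrans, isTrivialBlock_of_isBlock := ?_ }
    (isThreeCycle_swap_mul_swap_same hpa hpb hab) hT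
  intro B hB
  by_contra hnt
  rw [MulAction.IsTrivialBlock, not_or, Set.not_subsingleton_iff] at hnt
  obtain ⟨hnt, hne⟩ := hnt
  have key : ∀ k ∈ G, ∀ x, x ∈ B → k x ∈ B → ∀ y, k y ∈ B ↔ y ∈ B := by
    intro k hk x hx hkx y
    have h1 : (⟨k, hk⟩ : G) • B = B := by
      have := MulAction.isBlock_iff_smul_eq_of_mem.1 hB (g := ⟨k, hk⟩) hx hkx
      exact this
    constructor
    · intro hy
      rw [← h1] at hy
      obtain ⟨w, hw, hwy⟩ := hy
      have : w = y := k.injective hwy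
      exact this ▸ hw
    · intro hy
      rw [← h1]
      exact ⟨y, hy, rfl⟩
  apply hne
  obtain ⟨x₀, hx₀⟩ := hnt.nonempty
  refine Set.eq_univ_of_forall fun y => ?_
  refine (h (fun x y => ∀ g ∈ G, (g x ∈ B ↔ g y ∈ B)) ⟨fun x g _ => Iff.rfl,
    fun hxy g hg => (hxy g hg).symm, fun hxy hyz g hg => (hxy g hg).trans (hyz g hg)⟩
    (fun g hg x y hxy k hk => hxy (k * g) (mul_mem hk hg)) ?_ x₀ y 1 (one_mem _)).1 hx₀
  intro g hg
  have hk : g * T * g⁻¹ ∈ G := mul_mem (mul_mem hg hT) (inv_mem hg)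
  have keyT : ∀ x, g x ∈ B → g (T x) ∈ B → ∀ y, g (T y) ∈ B ↔ g y ∈ B := by
    intro x hx hTx y
    simpa using key _ hk (g x) hx (by simpa using hTx) (g y)
  have hmove : ∀ s, g s ∈ B → (s = p ∨ s = a) → ∀ y, g (T y) ∈ B ↔ g y ∈ B := by
    intro s hs hsp
    obtain ⟨z', hz', hzs⟩ := hnt.exists_ne (g s)
    obtain ⟨z, rfl⟩ := g.surjective z'
    have hzs : z ≠ s := fun e => hzs (e ▸ rfl)
    by_cases hzT : T z = z
    · exact keyT z hz' (hzT.symm ▸ hz')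
    · have : T z = s ∨ T s = z := by
        by_contra! hcon
        rcases hsp with rfl | rfl <;> grind
      rcases this with e | e
      · exact keyT z hz' (e.symm ▸ hs)
      · exact keyT s hs (e.symm ▸ hz')
  constructor
  · intro hp
    have := hmove p hp (.inl rfl)
    rw [← Tb, this, ← Tp, this]; exact hp
  · intro ha
    have := hmove a ha (.inr rfl)
    rw [← Ta, this]; exact ha

/-- The permutation of `ι → A` acting on coordinate `j` by a permutation of `A` depending on
the other coordinates. -/
def fiberPerm {ι A : Type*} [DecidableEq ι] (j : ι) (σ : ({i // i ≠ j} → A) → Perm A) :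
    Perm (ι → A) :=
  (funSplitAt j A).symm.permCongr (prodCongrLeft σ)

section fiberPerm
variable {ι A : Type*} [DecidableEq ι] (j : ι) (σ τ : ({i // i ≠ j} → A) → Perm A)

theorem fiberPerm_apply (x : ι → A) :
    fiberPerm j σ x = Function.update x j (σ (fun i => x i) (x j)) := by
  ext i
  by_cases h : i = j
  · subst h; simp [fiberPerm, permCongr_apply, funSplitAt, piSplitAt]
  · simp [fiberPerm, permCongr_apply, funSplitAt, piSplitAt, h]

theorem fiberPerm_mul : fiberPerm j σ * fiberPerm j τ = fiberPerm j (σ * τ) := by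
  ext x i
  have : (fun i : {i // i ≠ j} => Function.update x j (τ (fun i => x i) (x j)) i) =
      fun i : {i // i ≠ j} => x i := by
    funext i; simp [i.2]
  simp [fiberPerm_apply, this]

theorem fiberPerm_pow (k : ℕ) : fiberPerm j σ ^ k = fiberPerm j (σ ^ k) := by
  induction k with
  | zero => ext x i; simp [fiberPerm_apply]
  | succ k ih => rw [pow_succ, ih, fiberPerm_mul, pow_succ]

theorem sign_fiberPerm [Fintype ι] [Fintype A] [DecidableEq A] :
    sign (fiberPerm j σ) = ∏ c, sign (σ c) := by
  rw [fiberPerm, sign_permCongr, sign_prodCongrLeft]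

theorem fiberPerm_swap [Fintype ι] [DecidableEq A] (x : ι → A) (a b : A) :
    fiberPerm j (fun c => if c = (fun i : {i // i ≠ j} => x i) then swap a b else 1) =
      swap (Function.update x j a) (Function.update x j b) := by
  ext y i
  rw [fiberPerm_apply]
  by_cases h : (fun i : {i // i ≠ j} => y i) = fun i : {i // i ≠ j} => x i
  · have hy : y = Function.update x j (y j) := by
      funext i
      by_cases hi : i = j
      · subst hi; simp
      · simpa [hi] using congrFun h ⟨i, hi⟩
    simp only [h, if_true]
    generalize y j = c at *
    subst hy
    have hinj := Function.update_injective x j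
    rw [hinj.swap_apply]
    simp
  · rw [if_neg h, one_apply, Function.update_eq_self, swap_apply_of_ne_of_ne] <;>
    · rintro rfl
      exact h (funext fun i => by simp [i.2])

end fiberPerm

theorem forall_of_forall_update {ι A : Type*} [Fintype ι] [DecidableEq ι] (P : (ι → A) → Prop)
    {x₀ : ι → A} (h₀ : P x₀) (h : ∀ x j b, P x → P (Function.update x j b)) (y : ι → A) : P y := by
  have : ∀ s : Finset ι, P (s.piecewise y x₀) := by
    intro s
    induction s using Finset.induction_on with
    | empty => simpa using h₀
    | insert j s _ ih => rw [Finset.piecewise_insert]; exact h _ _ _ ih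
  simpa using this Finset.univ

/-- A permutation updating the coordinate `i₀` by `θ` on the line where all other coordinates
are `z`, and by `ρ` on every other line. -/
def lineInstr {ι A : Type*} [Fintype ι] [DecidableEq ι] [DecidableEq A] (i₀ : ι) (z : A)
    (θ ρ : Perm A) : Perm (ι → A) :=
  fiberPerm i₀ fun c => if c = fun _ => z then θ else ρ

/-- A permutation updating the coordinate `j ≠ i₀` by `θ` if the coordinate `i₀` is `u`,
and by `τ` otherwise. -/
def controlledInstr {ι A : Type*} [DecidableEq ι] [DecidableEq A] {i₀ j : ι} (h : i₀ ≠ j) (u : A)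
    (θ τ : Perm A) : Perm (ι → A) :=
  fiberPerm j fun c => if c ⟨i₀, h⟩ = u then θ else τ

section instructions
variable {ι A : Type*} [DecidableEq ι] [DecidableEq A]

theorem controlledInstr_pow {i₀ j : ι} (h : i₀ ≠ j) (u : A) (θ τ : Perm A) (k : ℕ) :
    controlledInstr h u θ τ ^ k = controlledInstr h u (θ ^ k) (τ ^ k) := by
  rw [controlledInstr, fiberPerm_pow, controlledInstr]
  congr 1
  funext c
  rw [Pi.pow_apply]
  split_ifs <;> rfl

theorem controlledInstr_apply {i₀ j : ι} (h : i₀ ≠ j) (u : A) (θ τ : Perm A) (x : ι → A) :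
    controlledInstr h u θ τ x =
      Function.update x j ((if x i₀ = u then θ else τ) (x j)) := by
  rw [controlledInstr, fiberPerm_apply]
variable [Fintype ι]

theorem lineInstr_pow (i₀ : ι) (z : A) (θ ρ : Perm A) (k : ℕ) :
    lineInstr i₀ z θ ρ ^ k = lineInstr i₀ z (θ ^ k) (ρ ^ k) := by
  rw [lineInstr, fiberPerm_pow, lineInstr]
  congr 1
  funext c
  rw [Pi.pow_apply]
  split_ifs <;> rfl

theorem lineInstr_apply_of_ne {i₀ j : ι} (h : j ≠ i₀) {z : A} (θ ρ : Perm A) {x : ι → A}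
    (hx : x j ≠ z) : lineInstr i₀ z θ ρ x = Function.update x i₀ (ρ (x i₀)) := by
  rw [lineInstr, fiberPerm_apply, if_neg]
  exact fun e => hx (congrFun e ⟨j, h⟩)

theorem lineInstr_swap_mul_swap (i₀ : ι) (z a b c d : A) :
    lineInstr i₀ z (swap a b * swap c d) 1 =
      swap (Function.update (fun _ => z) i₀ a) (Function.update (fun _ => z) i₀ b) *
      swap (Function.update (fun _ => z) i₀ c) (Function.update (fun _ => z) i₀ d) := by
  rw [← fiberPerm_swap, ← fiberPerm_swap, fiberPerm_mul, lineInstr]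
  congr 1
  funext k
  rw [Pi.mul_apply]
  split_ifs <;> simp

theorem congruence_eq_top {i₀ j₀ : ι} (hj₀ : i₀ ≠ j₀) {f y u z o t : A} {θ ρ τ : Perm A}
    {G : Subgroup (Perm (ι → A))}
    (hfu : f ≠ u) (hyu : y ≠ u) (hzo : z ≠ o) (htz : t ≠ z) (hto : t ≠ o)
    (hτo : τ o = z) (hτ : ∀ a b, ∃ k : ℕ, (τ ^ k) a = b)
    (hρf : ρ f = f) (hρ : ∀ a, a ≠ f → ∃ k : ℕ, (ρ ^ k) y = a)
    (hline : lineInstr i₀ z θ ρ ∈ G)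
    (hctrl : ∀ (j : ι) (h : i₀ ≠ j), controlledInstr h u (swap z o) τ ∈ G)
    (E : (ι → A) → (ι → A) → Prop) (hE : Equivalence E)
    (hinv : ∀ g ∈ G, ∀ x y, E x y → E (g x) (g y))
    (hfy : E (Function.update (fun _ => z) i₀ f) (Function.update (fun _ => z) i₀ y))
    (v w : ι → A) : E v w := by
  have hpow (j : ι) (h : i₀ ≠ j) (k : ℕ) {x y : ι → A} (hxy : E x y) :
      E (controlledInstr h u (swap z o ^ k) (τ ^ k) x)
        (controlledInstr h u (swap z o ^ k) (τ ^ k) y) := by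
    rw [← controlledInstr_pow]
    exact hinv _ (pow_mem (hctrl j h) k) _ _ hxy
  have hD : ∀ x, E (Function.update x i₀ f) (Function.update x i₀ y) := by
    refine forall_of_forall_update _ hfy fun x j b hx => ?_
    by_cases hj : i₀ = j
    · subst hj; simpa using hx
    · obtain ⟨k, hk⟩ := hτ (x j) b
      have := hpow j hj k hx
      simp only [controlledInstr_apply, Function.update_self, hfu, hyu, if_false,
        Function.update_of_ne (Ne.symm hj), hk] at this
      rwa [Function.update_comm (Ne.symm hj), Function.update_comm (Ne.symm hj)]
  have hL₁ : ∀ x a, (∃ j, j ≠ i₀ ∧ x j ≠ z) →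
      E (Function.update x i₀ f) (Function.update x i₀ a) := by
    rintro x a ⟨j, hj, hxj⟩
    by_cases ha : a = f
    · exact ha ▸ hE.refl _
    obtain ⟨k, hk⟩ := hρ a ha
    have := hinv _ (pow_mem hline k) _ _ (hD x)
    rw [lineInstr_pow, lineInstr_apply_of_ne hj, lineInstr_apply_of_ne hj] at this
    · simpa [hk, pow_apply_eq_self_of_apply_eq_self hρf k] using this
    all_goals simpa [hj] using hxj
  have hL₂ : ∀ x a, E (Function.update x i₀ f) (Function.update x i₀ a) := by
    intro x a
    by_cases hx : ∃ j, j ≠ i₀ ∧ x j ≠ z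
    · exact hL₁ x a hx
    · push Not at hx
      have hxj := hx j₀ hj₀.symm
      have := hinv _ (hctrl j₀ hj₀) _ _
        (hL₁ (Function.update x j₀ o) a ⟨j₀, hj₀.symm, by simpa using hzo.symm⟩)
      have hgo : ∀ b, controlledInstr hj₀ u (swap z o) τ
          (Function.update (Function.update x j₀ o) i₀ b) = Function.update x i₀ b := by
        intro b
        rw [controlledInstr_apply, Function.update_of_ne hj₀.symm, Function.update_self,
          Function.update_self, Function.update_comm hj₀, Function.update_idem]
        have : (if b = u then swap z o else τ) o = x j₀ := by
          split_ifs <;> simp [hxj, hτo]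
        rw [this, Function.update_eq_self]
      rwa [hgo, hgo] at this
  have hL : ∀ x a, E x (Function.update x i₀ a) := fun x a => by
    simpa using hE.trans (hE.symm (hL₂ x (x i₀))) (hL₂ x a)
  have hC : ∀ x j, i₀ ≠ j → E x (Function.update x j t) := by
    intro x j hj
    obtain ⟨k, hk⟩ := hτ t (x j)
    have h₁ := hpow j hj k (hL₂ (Function.update x j t) u)
    have hfix : (swap z o ^ k) t = t :=
      pow_apply_eq_self_of_apply_eq_self (swap_apply_of_ne_of_ne htz hto) k
    simp only [controlledInstr_apply, Function.update_self, hfu, if_false, if_true,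
      Function.update_of_ne (Ne.symm hj), hk, hfix] at h₁
    rw [Function.update_comm hj, Function.update_idem, Function.update_eq_self,
      Function.update_comm hj, Function.update_idem] at h₁
    refine hE.trans (hL x f) (hE.trans h₁ ?_)
    exact hE.symm (hL _ u)
  refine forall_of_forall_update (fun w => E v w) (hE.refl v) (fun x j b hx => ?_) w
  refine hE.trans hx ?_
  by_cases hj : i₀ = j
  · exact hj ▸ hL x b
  · have := hC (Function.update x j b) j hj
    rw [Function.update_idem] at this
    exact hE.trans (hC x j hj) (hE.symm this)

end instructions

theorem pow_card_eq_one_of_isCycleOn {A : Type*} [DecidableEq A] [Fintype A] {s : Finset A}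
    {ρ : Perm A} (h : ρ.IsCycleOn s) (hs : ρ.support ⊆ s) : ρ ^ s.card = 1 := by
  ext a
  by_cases ha : a ∈ s
  · simpa using h.pow_card_apply ha
  · have : ρ a = a := by
      by_contra hne
      exact ha (hs (mem_support.2 hne))
    simpa using pow_apply_eq_self_of_apply_eq_self this _

theorem exists_alternating_generators {ι A : Type*} [Fintype ι] [DecidableEq ι] [Fintype A]
    [DecidableEq A] (hA : 3 < Fintype.card A) (heven : Even (Fintype.card A))
    (hmod : Fintype.card A % 3 ≠ 1) [Nontrivial ι] :
    ∃ g : ι → Perm (ι → A), Function.Injective g ∧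
      (∀ j, (∀ x i, i ≠ j → g j x i = x i) ∧ g j ∈ alternatingGroup (ι → A)) ∧
      Subgroup.closure (Set.range g) = alternatingGroup (ι → A) := by
  obtain ⟨i₀, j₀, hj₀⟩ := exists_pair_ne ι
  obtain ⟨f, y, y', u, hfy, hfy', hfu, hyy', hyu, hy'u⟩ : ∃ f y y' u : A,
      f ≠ y ∧ f ≠ y' ∧ f ≠ u ∧ y ≠ y' ∧ y ≠ u ∧ y' ≠ u := by
    let e := (Fintype.equivFin A).symm
    refine ⟨e ⟨0, by omega⟩, e ⟨1, by omega⟩, e ⟨2, by omega⟩, e ⟨3, by omega⟩, ?_⟩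
    simp
  have : Nontrivial A := ⟨f, y, hfy⟩
  obtain ⟨τ, hτ, -⟩ := Finset.exists_cycleOn (Finset.univ : Finset A)
  rw [Finset.coe_univ] at hτ
  have hτc : τ.IsCycle := isCycle_iff_exists_isCycleOn.2
    ⟨Set.univ, Set.nontrivial_univ, hτ, fun _ _ => trivial⟩
  have hτne : ∀ a, τ a ≠ a := fun a => hτ.apply_ne Set.nontrivial_univ trivial
  have hτs : sign τ = -1 := by
    have : τ.support = Finset.univ := by ext a; simpa using hτne a
    rw [hτc.sign, this, Finset.card_univ, heven.neg_one_pow]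
  obtain ⟨ρ, hρ, hρs⟩ := Finset.exists_cycleOn ({f}ᶜ : Finset A)
  have hρf : ρ f = f := by
    by_contra hne
    simpa using hρs (mem_support.2 hne)
  have hρ1 : ρ ^ (Fintype.card A - 1) = 1 := by
    simpa [Finset.card_compl] using pow_card_eq_one_of_isCycleOn hρ hρs
  have hyfc : y ∈ ({f}ᶜ : Finset A) := by simpa using hfy.symm
  set z := f with hz
  set o := τ⁻¹ f with ho
  have hτo : τ o = z := by simp [ho, hz]
  have hzo : z ≠ o := fun e => hτne o (by rw [hτo, e])
  obtain ⟨t, ht⟩ : ∃ t, t ∉ ({z, o} : Finset A) := by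
    by_contra! hcon
    have := Finset.card_le_card (fun a _ => hcon a : Finset.univ ⊆ ({z, o} : Finset A))
    have := Finset.card_le_two (a := z) (b := o)
    rw [Finset.card_univ] at *
    omega
  simp only [Finset.mem_insert, Finset.mem_singleton, not_or] at ht
  set θ := swap f y * swap f y' with hθ
  have hθ3 : θ ^ 3 = 1 := by
    have := (isThreeCycle_swap_mul_swap_same hfy hfy' hyy').orderOf
    rw [← this]; exact pow_orderOf_eq_one θ
  let g : ι → Perm (ι → A) := fun j =>
    if h : i₀ = j then lineInstr i₀ z θ ρ else controlledInstr h u (swap z o) τ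
  have g_line : g i₀ = lineInstr i₀ z θ ρ := by simp [g]
  have g_ctrl : ∀ j (h : i₀ ≠ j), g j = controlledInstr h u (swap z o) τ := by
    intro j h; simp [g, h]
  have hinstr : ∀ j x i, i ≠ j → g j x i = x i := by
    intro j x i hij
    by_cases h : i₀ = j
    · subst h
      simp [g_line, lineInstr, fiberPerm_apply, hij]
    · simp [g_ctrl j h, controlledInstr_apply, hij]
  have hT : lineInstr i₀ z θ ρ ^ ((Fintype.card A - 1) ^ 2) = lineInstr i₀ z θ 1 := by
    have hk : (Fintype.card A - 1) ^ 2 % 3 = 1 := by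
      have : (Fintype.card A - 1) % 3 = 1 ∨ (Fintype.card A - 1) % 3 = 2 := by omega
      rcases this with h | h <;> simp [Nat.pow_mod, h]
    rw [lineInstr_pow, pow_eq_pow_mod _ hθ3, hk, pow_one, sq, pow_mul, hρ1, one_pow]
  rw [hθ, lineInstr_swap_mul_swap] at hT
  have hupd := Function.update_injective (fun _ : ι => z) i₀
  have hne : ∀ j, g j ≠ 1 := by
    intro j hj
    by_cases h : i₀ = j
    · subst h
      rw [← hθ, ← g_line, hj, one_pow] at hT
      have h3 := isThreeCycle_swap_mul_swap_same (hupd.ne hfy) (hupd.ne hfy') (hupd.ne hyy')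
      rw [← hT] at h3
      exact absurd h3.orderOf (by simp)
    · have := congrFun (congrArg DFunLike.coe hj) fun _ => f
      rw [g_ctrl j h, controlledInstr_apply, if_neg hfu] at this
      exact hτne f (by simpa using congrFun this j)
  have halt : ∀ j, g j ∈ alternatingGroup (ι → A) := by
    intro j
    rw [mem_alternatingGroup]
    by_cases h : i₀ = j
    · subst h
      have h1 : g i₀ ^ (3 * (Fintype.card A - 1)) = 1 := by
        rw [g_line, lineInstr_pow, pow_mul, hθ3, one_pow, mul_comm, pow_mul, hρ1, one_pow]
        ext x i
        simp [lineInstr, fiberPerm_apply]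
      have h2 := congrArg sign h1
      have hodd : Odd (3 * (Fintype.card A - 1)) := by
        rw [Nat.odd_mul]
        exact ⟨by decide, by obtain ⟨m, hm⟩ := heven; exact ⟨m - 1, by omega⟩⟩
      rw [map_pow, map_one] at h2
      rcases Int.units_eq_one_or (sign (g i₀)) with h3 | h3
      · exact h3
      · rw [h3, hodd.neg_one_pow] at h2
        exact absurd h2 (by decide)
    · rw [g_ctrl j h, controlledInstr, sign_fiberPerm]
      have : ∀ c : {i // i ≠ j} → A,
          sign (if c ⟨i₀, h⟩ = u then swap z o else τ) = -1 := by
        intro c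
        split_ifs
        · exact sign_swap hzo
        · exact hτs
      rw [Finset.prod_congr rfl fun c _ => this c, Finset.prod_const, Finset.card_univ]
      refine Even.neg_one_pow ?_
      rw [Fintype.card_fun]
      have : Nonempty {i // i ≠ j} := ⟨⟨i₀, h⟩⟩
      exact heven.pow_of_ne_zero Fintype.card_ne_zero
  refine ⟨g, ?_, fun j => ⟨hinstr j, halt j⟩, le_antisymm ?_ ?_⟩
  · intro j k hjk
    by_contra hne'
    refine hne j (Equiv.ext fun x => funext fun i => ?_)
    by_cases hi : i = j
    · rw [hjk]
      exact hinstr k x i (hi ▸ hne')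
    · exact hinstr j x i hi
  · rw [Subgroup.closure_le]
    rintro _ ⟨j, rfl⟩
    exact halt j
  · have hmem : ∀ j, g j ∈ Subgroup.closure (Set.range g) :=
      fun j => Subgroup.subset_closure ⟨j, rfl⟩
    refine alternatingGroup_le_of_swap_mul_swap_mem_of_congruence (hupd.ne hfy) (hupd.ne hfy')
      (hupd.ne hyy') (hT ▸ pow_mem (g_line ▸ hmem i₀) _) fun E hE hinv hE0 =>
      congruence_eq_top (ρ := ρ) (θ := θ) (τ := τ) hj₀ hfu hyu hzo ht.1 ht.2 hτo ?_ hρf ?_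
        (g_line ▸ hmem i₀) (fun j h => g_ctrl j h ▸ hmem j) E hE hinv hE0
    · intro a b
      have hτ' : τ.IsCycleOn ((Finset.univ : Finset A) : Set A) := by simpa using hτ
      obtain ⟨k, -, hk⟩ := hτ'.exists_pow_eq (Finset.mem_univ a) (Finset.mem_univ b)
      exact ⟨k, hk⟩
    · intro a ha
      obtain ⟨k, -, hk⟩ := hρ.exists_pow_eq hyfc (b := a) (by simpa using ha)
      exact ⟨k, hk⟩

end helpers

/-- If `q > 2` and `q ≡ 0` or `2 (mod 6)`, then `Alt(A^n)` is generated by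
`n` even instructions. -/
theorem alternating_generated_q_0_2_mod_6
    (q n : ℕ) (A : Type*) [Fintype A] [DecidableEq A]
    (hA : Fintype.card A = q) (hq : 2 < q)
    (hmod : q % 6 = 0 ∨ q % 6 = 2) (hn : 2 ≤ n) :
    ∃ X : Finset (Equiv.Perm (Fin n → A)),
      X.card = n ∧
      (∀ g ∈ X, IsInstruction g ∧ g ∈ alternatingGroup (Fin n → A)) ∧
      Subgroup.closure (X : Set (Equiv.Perm (Fin n → A))) =
        alternatingGroup (Fin n → A) := by
  have : Nontrivial (Fin n) := Fin.nontrivial_iff_two_le.2 hn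
  obtain ⟨g, hinj, hg, hgen⟩ := exists_alternating_generators (ι := Fin n) (A := A)
    (by omega) (Nat.even_iff.2 (by omega)) (by omega)
  refine ⟨Finset.univ.image g, by simp [Finset.card_image_of_injective _ hinj], ?_, by simpa⟩
  intro _ hX
  obtain ⟨j, -, rfl⟩ := Finset.mem_image.1 hX
  exact ⟨⟨j, (hg j).1⟩, (hg j).2⟩
end

section
/- If q > 4 with q ≡ 4 (mod 6) and n ≥ 2, then there exists a set of n instructions on A^n, each of which is an even permutation, that generates the alternating group Alt(A^n). -/
open Equiv Equiv.Perm MulAction Pointwise in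
/-- A transitive permutation group containing a 3-cycle contains the alternating group as soon as
each generator maps some point moved by the 3-cycle to a point moved by the 3-cycle. -/
theorem alternatingGroup_le_closure_of_isThreeCycle {α : Type*} [Fintype α] [DecidableEq α]
    {S : Set (Perm α)} {τ : Perm α} (hτ : τ.IsThreeCycle) (hτS : τ ∈ Subgroup.closure S)
    (htrans : IsPretransitive (Subgroup.closure S) α)
    (hS : ∀ s ∈ S, ∃ x ∈ τ.support, s x ∈ τ.support) :
    alternatingGroup α ≤ Subgroup.closure S := by
  refine alternatingGroup_le_of_isPreprimitive_of_isThreeCycle_mem ?_ hτ hτS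
  obtain ⟨a, ha⟩ : τ.support.Nonempty := by
    rw [← Finset.card_pos, hτ.card_support]; norm_num
  refine IsPreprimitive.of_isTrivialBlock_base a fun {B} haB hB => ?_
  rw [IsTrivialBlock, or_iff_not_imp_left, Set.not_subsingleton_iff]
  intro hnt
  obtain ⟨b, hbB, hba⟩ := hnt.exists_ne a
  have orb : ∀ x ∈ τ.support, ∃ k < 3, (τ ^ k) a = x := by
    intro x hx
    obtain ⟨k, hk, hkx⟩ := (hτ.isCycle.sameCycle (mem_support.1 ha) (mem_support.1 hx)).exists_pow_eq'
    exact ⟨k, hτ.orderOf ▸ hk, hkx⟩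
  have key : ∀ g ∈ Subgroup.closure S, ∀ x ∈ B, g x ∈ B → ∀ y, y ∈ B → g y ∈ B := by
    intro g hg x hx hgx y hy
    have h := isBlock_iff_smul_eq_of_mem.1 hB (g := ⟨g, hg⟩) hx hgx
    rw [← h]
    exact Set.smul_mem_smul_set hy
  have hτB : ∀ y, y ∈ B → τ y ∈ B := by
    by_cases hb : b ∈ τ.support
    · obtain ⟨k, hk, rfl⟩ := orb b hb
      interval_cases k
      · exact absurd rfl hba
      · exact key τ hτS a haB (by simpa using hbB)
      · refine key τ hτS _ hbB ?_
        have h3 : τ ^ 3 = 1 := hτ.orderOf ▸ pow_orderOf_eq_one τ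
        rw [← Perm.mul_apply, ← pow_succ', h3]
        exact haB
    · exact key τ hτS b hbB (by rwa [notMem_support.1 hb])
  have hsupp : ∀ x ∈ τ.support, x ∈ B := by
    intro x hx
    obtain ⟨k, hk, rfl⟩ := orb x hx
    interval_cases k
    · exact haB
    · exact hτB _ haB
    · exact hτB _ (hτB _ haB)
  have hfix : ∀ g : Subgroup.closure S, g • B = B := by
    rintro ⟨g, hg⟩
    have hsub : Subgroup.closure S ≤ stabilizer (Perm α) B := by
      rw [Subgroup.closure_le]
      intro s hs
      obtain ⟨x, hx, hsx⟩ := hS s hs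
      exact isBlock_iff_smul_eq_of_mem.1 hB (g := ⟨s, Subgroup.subset_closure hs⟩)
        (hsupp x hx) (hsupp _ hsx)
    exact hsub hg
  refine Set.eq_univ_of_forall fun y => ?_
  obtain ⟨g, rfl⟩ := exists_smul_eq (Subgroup.closure S) a y
  rw [← hfix g]
  exact Set.smul_mem_smul_set haB

open Equiv Equiv.Perm in
/-- The permutations of `ι → A` updating only the coordinate `j`, by a permutation of `A` that
depends on the other coordinates. -/
def conditionalUpdate {ι A : Type*} [DecidableEq ι] (j : ι) :
    (({i // i ≠ j} → A) → Perm A) →* Perm (ι → A) where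
  toFun f := (funSplitAt j A).symm.permCongr (prodCongrLeft f)
  map_one' := by
    ext x i
    by_cases h : i = j <;> simp [funSplitAt, h, prodCongrLeft]
  map_mul' f g := by
    ext x i
    simp [Equiv.permCongr_apply, prodCongrLeft]

section conditionalUpdate

open Equiv Equiv.Perm

variable {ι A : Type*} [DecidableEq ι]

theorem conditionalUpdate_apply (j : ι) (f : ({i // i ≠ j} → A) → Perm A) (x : ι → A) :
    conditionalUpdate j f x = Function.update x j (f (fun i => x i) (x j)) := by
  ext i
  by_cases h : i = j
  · subst h
    simp [conditionalUpdate, funSplitAt, prodCongrLeft]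
  · simp [conditionalUpdate, funSplitAt, prodCongrLeft, h]

theorem sign_conditionalUpdate [Fintype ι] [Fintype A] [DecidableEq A] (j : ι)
    (f : ({i // i ≠ j} → A) → Perm A) : sign (conditionalUpdate j f) = ∏ p, sign (f p) := by
  rw [← sign_prodCongrLeft]
  exact sign_permCongr _ _

theorem prod_comp_eval [Fintype ι] [Fintype A] {M : Type*} [CommMonoid M] (i : ι) (f : A → M) :
    ∏ p : ι → A, f (p i) = (∏ a, f a) ^ Fintype.card ({k // k ≠ i} → A) := by
  rw [Fintype.prod_equiv (funSplitAt i A) (fun p => f (p i)) (fun z => f z.1) (fun x => rfl),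
    Fintype.prod_prod_type_right]
  simp

theorem conditionalUpdate_mulSingle_swap [Fintype ι] [DecidableEq A] (j : ι) (x : ι → A)
    (a b : A) :
    conditionalUpdate j (Pi.mulSingle (fun i : {i // i ≠ j} => x i) (swap a b)) =
      swap (Function.update x j a) (Function.update x j b) := by
  ext1 y
  rw [conditionalUpdate_apply]
  by_cases h : (fun i : {i // i ≠ j} => y i) = fun i : {i // i ≠ j} => x i
  · obtain ⟨c, rfl⟩ : ∃ c, y = Function.update x j c := by
      refine ⟨y j, ?_⟩
      ext i
      by_cases hi : i = j
      · subst hi; simp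
      · simpa [hi] using congrFun h ⟨i, hi⟩
    rw [h, Pi.mulSingle_eq_same]
    simp only [swap_apply_def, Function.update_self, Function.update_idem,
      (Function.update_injective x j).eq_iff]
    split_ifs <;> rfl
  · have hne : ∀ c, y ≠ Function.update x j c := by
      rintro c rfl
      exact h (funext fun i => by simp [i.2])
    rw [Pi.mulSingle_eq_of_ne h, swap_apply_of_ne_of_ne (hne a) (hne b)]
    simp

theorem isThreeCycle_conditionalUpdate_mulSingle [Fintype ι] [Fintype A] [DecidableEq A] (j : ι)
    (x : ι → A) {a b c : A} (hab : a ≠ b) (hbc : b ≠ c) (hac : a ≠ c) :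
    (conditionalUpdate j
      (Pi.mulSingle (fun i : {i // i ≠ j} => x i) (swap a b * swap b c))).IsThreeCycle := by
  have hinj := Function.update_injective x j
  rw [Pi.mulSingle_mul, map_mul, conditionalUpdate_mulSingle_swap,
    conditionalUpdate_mulSingle_swap, swap_comm (Function.update x j a)]
  exact isThreeCycle_swap_mul_swap_same (hinj.ne hab.symm) (hinj.ne hbc) (hinj.ne hac)

/-- A group of permutations of `ι → A` is transitive if it contains cyclic shifts of each coordinate
`j ≠ i₀`, active unless the coordinate `i₀` is `a` or `b`, and a permutation of the coordinate `i₀`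
which is a cyclic shift except on the line where all other coordinates equal `c`, and which maps
`a` to `b` to `c` on that line. -/
theorem isPretransitive_closure_of_cyclic [Finite A] [Fintype ι] {i₀ i₁ : ι} (hi : i₁ ≠ i₀)
    {σ ρ : Perm A} (hσ : σ.IsCycleOn Set.univ) {a b c : A} (hab : ρ a = b) (hbc : ρ b = c)
    (hca : c ≠ a) (hcb : c ≠ b) {g : ι → Perm (ι → A)}
    (hline : ∀ x : ι → A, (∀ i ≠ i₀, x i = c) → g i₀ x = Function.update x i₀ (ρ (x i₀)))
    (hoff : ∀ x : ι → A, (¬ ∀ i ≠ i₀, x i = c) → g i₀ x = Function.update x i₀ (σ (x i₀)))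
    (hg : ∀ j ≠ i₀, ∀ x : ι → A, x i₀ ≠ a → x i₀ ≠ b →
      g j x = Function.update x j (σ (x j))) :
    MulAction.IsPretransitive (Subgroup.closure (Set.range g)) (ι → A) := by
  set G := Subgroup.closure (Set.range g)
  have hmem : ∀ j, g j ∈ G := fun j => Subgroup.subset_closure ⟨j, rfl⟩
  let O : Set (ι → A) := MulAction.orbit G (fun _ => c)
  have hO : ∀ f ∈ G, ∀ x, f x ∈ O ↔ x ∈ O := fun f hf x =>
    MulAction.mem_orbit_symm.trans <| by
      rw [← MulAction.orbit_eq_iff, ← MulAction.orbit_eq_iff,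
        ← MulAction.orbit_smul (⟨f, hf⟩ : G) x]
      exact eq_comm
  have hpow : ∀ j (x : ι → A), (∀ t, g j (Function.update x j t) = Function.update x j (σ t)) →
      ∀ t, Function.update x j t ∈ O → x ∈ O := by
    intro j x h t ht
    obtain ⟨k, hk⟩ := hσ.exists_pow_eq' Set.finite_univ (Set.mem_univ t) (Set.mem_univ (x j))
    have hiter : ∀ k : ℕ, (g j ^ k) (Function.update x j t) =
        Function.update x j ((σ ^ k) t) := by
      intro k
      induction k with
      | zero => rfl
      | succ k ih => rw [pow_succ', Perm.mul_apply, ih, h, pow_succ', Perm.mul_apply]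
    have := (hO _ (pow_mem (hmem j) k) _).2 ht
    rwa [hiter, hk, Function.update_eq_self] at this
  have hface : ∀ s : Finset ι, ∀ x : ι → A, x i₀ = c → (∀ i ∉ s, x i = c) → x ∈ O := by
    intro s
    induction s using Finset.induction_on with
    | empty =>
      intro x _ hx
      rw [funext fun i => hx i (Finset.notMem_empty i)]
      exact MulAction.mem_orbit_self _
    | insert j s _ ih =>
      intro x hx₀ hx
      by_cases hj : j = i₀
      · refine ih x hx₀ fun i his => ?_
        by_cases hij : i = j
        · rw [hij, hj, hx₀]
        · exact hx i (by simp [hij, his])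
      · refine hpow j x (fun t => ?_) c (ih _ ?_ fun i his => ?_)
        · rw [hg j hj]
          · simp
          · simpa [Ne.symm hj, hx₀] using hca
          · simpa [Ne.symm hj, hx₀] using hcb
        · simpa [Ne.symm hj] using hx₀
        · by_cases hij : i = j
          · simp [hij]
          · rw [Function.update_of_ne hij]
            exact hx i (by simp [hij, his])
  replace hface : ∀ x : ι → A, x i₀ = c → x ∈ O := fun x hx =>
    hface Finset.univ x hx (by simp)
  have hgen : ∀ x : ι → A, (¬ ∀ i ≠ i₀, x i = c) → x ∈ O := by
    intro x hx
    refine hpow i₀ x (fun t => ?_) c (hface _ (by simp))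
    rw [hoff]
    · simp
    · intro h
      exact hx fun i hi => by simpa [hi] using h i hi
  have hall : ∀ x, x ∈ O := by
    intro x
    by_cases hx : ∀ i ≠ i₀, x i = c
    swap
    · exact hgen x hx
    have hb : ∀ x : ι → A, (∀ i ≠ i₀, x i = c) → x i₀ = b → x ∈ O := by
      intro x hx hxb
      rw [← hO _ (hmem i₀), hline x hx]
      exact hface _ (by simp [hxb, hbc])
    by_cases hxb : x i₀ = b
    · exact hb x hx hxb
    by_cases hxa : x i₀ = a
    · rw [← hO _ (hmem i₀), hline x hx]
      exact hb _ (fun i hi => by simpa [hi] using hx i hi) (by simp [hxa, hab])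
    rw [← hO _ (hmem i₁), hg i₁ hi x hxa hxb]
    refine hgen _ fun h => ?_
    have := h i₁ hi
    rw [Function.update_self, hx i₁ hi] at this
    exact hσ.apply_ne (Set.nontrivial_of_mem_mem_ne (Set.mem_univ c) (Set.mem_univ a) hca)
      (Set.mem_univ c) this
  exact MulAction.isPretransitive_iff_orbit_eq_univ _ |>.2 (Set.eq_univ_of_forall hall)

end conditionalUpdate


/-- If `q > 4` and `q ≡ 4 (mod 6)`, then `Alt(A^n)` is generated by `n` even
instructions. -/
theorem alternating_generated_q_4_mod_6
    (q n : ℕ) (A : Type*) [Fintype A] [DecidableEq A]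
    (hA : Fintype.card A = q) (hq : 4 < q) (hmod : q % 6 = 4) (hn : 2 ≤ n) :
    ∃ X : Finset (Equiv.Perm (Fin n → A)),
      X.card = n ∧
      (∀ g ∈ X, IsInstruction g ∧ g ∈ alternatingGroup (Fin n → A)) ∧
      Subgroup.closure (X : Set (Equiv.Perm (Fin n → A))) =
        alternatingGroup (Fin n → A) := by
  open Equiv Equiv.Perm in
  obtain ⟨m, rfl⟩ : ∃ m, q = 6 * m + 4 := ⟨q / 6, by omega⟩
  obtain ⟨u⟩ : Nonempty (Fin 5 ↪ A) :=
    Function.Embedding.nonempty_of_card_le (by simp only [Fintype.card_fin]; omega)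
  obtain ⟨a, ha⟩ : ∃ a, a = u 0 := ⟨_, rfl⟩
  obtain ⟨b, hb⟩ : ∃ b, b = u 1 := ⟨_, rfl⟩
  obtain ⟨c, hc⟩ : ∃ c, c = u 2 := ⟨_, rfl⟩
  obtain ⟨d, hd⟩ : ∃ d, d = u 3 := ⟨_, rfl⟩
  obtain ⟨e, he⟩ : ∃ e, e = u 4 := ⟨_, rfl⟩
  have hab : a ≠ b := by simp [ha, hb]
  have hac : a ≠ c := by simp [ha, hc]
  have had : a ≠ d := by simp [ha, hd]
  have hae : a ≠ e := by simp [ha, he]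
  have hbc : b ≠ c := by simp [hb, hc]
  have hbd : b ≠ d := by simp [hb, hd]
  have hbe : b ≠ e := by simp [hb, he]
  have hcd : c ≠ d := by simp [hc, hd]
  have hce : c ≠ e := by simp [hc, he]
  have hde : d ≠ e := by simp [hd, he]
  -- the full cycle `σ`, the 3-cycle `τ` and the permutation `ρ` of order 6
  obtain ⟨σ, hσ, -⟩ := Finset.exists_cycleOn (Finset.univ : Finset A)
  have hσfix : ∀ t, σ t ≠ t := fun t =>
    hσ.apply_ne (by simpa using Set.nontrivial_of_mem_mem_ne (Set.mem_univ a) (Set.mem_univ b) hab)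
      (by simp)
  have hσsupp : σ.support = Finset.univ := by
    ext t; simp [hσfix t]
  have hσq : σ ^ (6 * m + 4) = 1 := by
    ext t
    rw [← hA]
    exact hσ.pow_card_apply (Finset.mem_univ t)
  have hσc : σ.IsCycle := isCycle_iff_exists_isCycleOn.2
    ⟨Set.univ, Set.nontrivial_of_mem_mem_ne (Set.mem_univ a) (Set.mem_univ b) hab,
      by simpa using hσ, by simp⟩
  have hσsign : sign σ = -1 := by
    rw [hσc.sign, hσsupp, Finset.card_univ, hA, Even.neg_one_pow ⟨3 * m + 2, by ring⟩]
  obtain ⟨τ, hτ⟩ : ∃ τ, τ = swap a b * swap b c := ⟨_, rfl⟩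
  have hτ3 : τ.IsThreeCycle := by
    rw [hτ, swap_comm a b]
    exact isThreeCycle_swap_mul_swap_same hab.symm hbc hac
  obtain ⟨ρ, hρ⟩ : ∃ ρ, ρ = τ * swap d e := ⟨_, rfl⟩
  have hρa : ρ a = b := by
    rw [hρ, hτ, mul_apply, mul_apply, swap_apply_of_ne_of_ne had hae,
      swap_apply_of_ne_of_ne hab hac, swap_apply_left]
  have hρb : ρ b = c := by
    rw [hρ, hτ, mul_apply, mul_apply, swap_apply_of_ne_of_ne hbd hbe, swap_apply_left,
      swap_apply_of_ne_of_ne hac.symm hbc.symm]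
  have hρc : ρ c = a := by
    rw [hρ, hτ, mul_apply, mul_apply, swap_apply_of_ne_of_ne hcd hce, swap_apply_right,
      swap_apply_right]
  have hρsign : sign ρ = -1 := by
    rw [hρ, map_mul, hτ3.sign, sign_swap hde, one_mul]
  have hρq : ρ ^ (6 * m + 4) = τ := by
    have hcomm : Commute τ (swap d e) := by
      rw [hτ]
      exact ((disjoint_swap_swap (by simp [*])).mul_left (disjoint_swap_swap (by simp [*]))).commute
    have h3 : τ ^ 3 = 1 := hτ3.orderOf ▸ pow_orderOf_eq_one τ
    rw [hρ, hcomm.mul_pow, show 6 * m + 4 = 3 * (2 * m + 1) + 1 by ring, pow_succ, pow_mul, h3,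
      one_pow, one_mul, show 3 * (2 * m + 1) + 1 = 2 * (3 * m + 2) by ring, pow_mul, sq (swap d e),
      swap_mul_self, one_pow, mul_one]
  -- the instructions
  obtain ⟨i₀, hi₀⟩ : ∃ i₀ : Fin n, i₀ = ⟨0, by omega⟩ := ⟨_, rfl⟩
  obtain ⟨i₁, hi₁⟩ : ∃ i₁ : Fin n, i₁ ≠ i₀ := ⟨⟨1, by omega⟩, by simp [hi₀]⟩
  obtain ⟨g, hg⟩ : ∃ g : Fin n → Perm (Fin n → A), g = fun j => conditionalUpdate j fun p =>
    if h : i₀ ≠ j then if p ⟨i₀, h⟩ = a ∨ p ⟨i₀, h⟩ = b then 1 else σ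
    else if p = fun _ => c then ρ else σ := ⟨_, rfl⟩
  have hg₀ : g i₀ = conditionalUpdate i₀ fun p => if p = fun _ => c then ρ else σ := by
    simp [hg]
  have hgj : ∀ j, ∀ h : i₀ ≠ j, g j = conditionalUpdate j fun p =>
      if p ⟨i₀, h⟩ = a ∨ p ⟨i₀, h⟩ = b then 1 else σ := by
    intro j h
    simp [hg, h]
  have hline : ∀ x : Fin n → A, (∀ i ≠ i₀, x i = c) →
      g i₀ x = Function.update x i₀ (ρ (x i₀)) := by
    intro x hx
    rw [hg₀, conditionalUpdate_apply, if_pos (funext fun i : {i // i ≠ i₀} => hx i i.2)]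
  have hoff : ∀ x : Fin n → A, (¬ ∀ i ≠ i₀, x i = c) →
      g i₀ x = Function.update x i₀ (σ (x i₀)) := by
    intro x hx
    rw [hg₀, conditionalUpdate_apply, if_neg fun h => hx fun i hi => congrFun h (⟨i, hi⟩ : {i // i ≠ i₀})]
  have hshift : ∀ j ≠ i₀, ∀ x : Fin n → A, x i₀ ≠ a → x i₀ ≠ b →
      g j x = Function.update x j (σ (x j)) := by
    intro j hj x hxa hxb
    rw [hgj j hj.symm, conditionalUpdate_apply, if_neg (by simp [hxa, hxb])]
  have hfix : ∀ j ≠ i₀, ∀ x : Fin n → A, x i₀ = a → g j x = x := by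
    intro j hj x hxa
    rw [hgj j hj.symm, conditionalUpdate_apply, if_pos (Or.inl hxa)]
    simp
  have hinstr : ∀ j (x : Fin n → A) i, i ≠ j → g j x i = x i := by
    intro j x i hij
    rw [hg, conditionalUpdate_apply, Function.update_of_ne hij]
  have hmove : ∀ j, g j (fun _ => c) j ≠ c := by
    intro j
    by_cases hj : j = i₀
    · subst hj
      rw [hline _ (fun _ _ => rfl), Function.update_self, hρc]
      exact hac
    · rw [hshift j hj _ hac.symm hbc.symm, Function.update_self]
      exact hσfix c
  have hginj : Function.Injective g := by
    intro i j hij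
    by_contra hne
    exact hmove i (by rw [hij, hinstr j _ i hne])
  have heven : ∀ j, g j ∈ alternatingGroup (Fin n → A) := by
    intro j
    rw [mem_alternatingGroup]
    by_cases hj : i₀ = j
    · subst hj
      rw [hg₀, sign_conditionalUpdate]
      have : ∀ p : {i // i ≠ i₀} → A, sign (if p = fun _ => c then ρ else σ) = -1 := by
        intro p; split_ifs <;> assumption
      simp only [this, Finset.prod_const, Finset.card_univ, Fintype.card_fun, hA]
      refine Even.neg_one_pow (Even.pow_of_ne_zero ⟨3 * m + 2, by ring⟩ ?_)
      exact (Fintype.card_pos_iff.2 ⟨⟨i₁, hi₁⟩⟩).ne'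
    · rw [hgj j hj, sign_conditionalUpdate,
        prod_comp_eval (⟨i₀, hj⟩ : {i // i ≠ j}) fun t => sign (if t = a ∨ t = b then 1 else σ)]
      have : ∏ t, sign (if t = a ∨ t = b then 1 else σ) = 1 := by
        simp only [apply_ite sign, Perm.sign_one, hσsign]
        rw [Finset.prod_ite, Finset.prod_const_one, one_mul, Finset.prod_const]
        have hcard : (Finset.univ.filter fun t => ¬ (t = a ∨ t = b)) = ({a, b} : Finset A)ᶜ := by
          ext t; simp
        rw [hcard, Finset.card_compl, Finset.card_pair hab, hA]
        exact Even.neg_one_pow ⟨3 * m + 1, by omega⟩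
      rw [this, one_pow]
  -- the power of the first instruction which is a 3-cycle
  have hpow : g i₀ ^ (6 * m + 4) = conditionalUpdate i₀
      (Pi.mulSingle (fun _ : {i // i ≠ i₀} => c) (swap a b * swap b c)) := by
    rw [hg₀, ← map_pow]
    congr 1
    ext1 p
    by_cases hp : p = fun _ => c
    · simp [hp, hρq, hτ]
    · simp [hp, hσq]
  refine ⟨Finset.univ.map ⟨g, hginj⟩, by simp, ?_, ?_⟩
  · intro f hf
    obtain ⟨j, -, rfl⟩ := Finset.mem_map.1 hf
    exact ⟨⟨j, hinstr j⟩, heven j⟩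
  · have hcoe : ((Finset.univ.map ⟨g, hginj⟩ : Finset _) : Set (Perm (Fin n → A))) =
        Set.range g := by simp
    rw [hcoe]
    refine le_antisymm ?_ ?_
    · rw [Subgroup.closure_le]
      rintro _ ⟨j, rfl⟩
      exact heven j
    · have h3 := isThreeCycle_conditionalUpdate_mulSingle i₀ (fun _ => c) hab hbc hac
      rw [← hpow] at h3
      refine alternatingGroup_le_closure_of_isThreeCycle h3
        (pow_mem (Subgroup.subset_closure (Set.mem_range_self i₀)) _)
        (isPretransitive_closure_of_cyclic hi₁ (by simpa using hσ) hρa hρb hac.symm hbc.symm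
          hline hoff hshift) ?_
      have hmem : ∀ t, ρ t ≠ t → t ≠ d → t ≠ e → Function.update (fun _ => c) i₀ t ∈
          (g i₀ ^ (6 * m + 4)).support := by
        intro t hρt htd hte
        rw [hρ, Perm.mul_apply, swap_apply_of_ne_of_ne htd hte] at hρt
        have hoth : (fun i : {i // i ≠ i₀} => Function.update (fun _ => c) i₀ t i) = fun _ => c :=
          funext fun i => Function.update_of_ne i.2 _ _
        rw [hpow, mem_support, conditionalUpdate_apply, ← hτ, hoth, Pi.mulSingle_eq_same,
          Function.update_self, Function.update_idem]
        exact (Function.update_injective _ _).ne hρt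
      have hma := hmem a (hρa.trans_ne hab.symm) had hae
      have hmc := hmem c (hρc.trans_ne hac) hcd hce
      rintro _ ⟨j, rfl⟩
      by_cases hj : j = i₀
      · subst hj
        refine ⟨_, hmc, ?_⟩
        rw [hline _ (fun i hi => by simp), Function.update_idem, Function.update_self, hρc]
        exact hma
      · refine ⟨_, hma, ?_⟩
        rw [hfix j hj _ (by simp)]
        exact hma
end

section
/- Let X be a set of exactly n instructions on A^n that generates the full symmetric group Sym(A^n). Then no element of X is a unary instruction. -/
/-- A *unary instruction* updates some register `j`, its nontrivial
coordinate function depending only on register `j` itself. -/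
def IsUnaryInstruction {n : ℕ} {A : Type*} (g : Equiv.Perm (Fin n → A)) : Prop :=
  ∃ j : Fin n, (∀ (x : Fin n → A) (i : Fin n), i ≠ j → g x i = x i) ∧
    ∃ h : Equiv.Perm A, ∀ x : Fin n → A, g x j = h (x j)

/-- If every element of `X` respects equality of the `k`-th coordinate, then `X` does not generate
the full symmetric group: its closure preserves a nontrivial block system. -/
theorem closure_ne_top_of_coordinate_congruence {ι A : Type*} [Nontrivial ι] [Nontrivial A]
    {X : Set (Equiv.Perm (ι → A))} (k : ι)
    (hX : ∀ g ∈ X, ∀ x y, g x k = g y k ↔ x k = y k) :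
    Subgroup.closure X ≠ ⊤ := by
  classical
  intro htop
  have hall : ∀ g : Equiv.Perm (ι → A), ∀ x y, g x k = g y k ↔ x k = y k := by
    intro g
    have hg : g ∈ Subgroup.closure X := htop ▸ Subgroup.mem_top g
    induction hg using Subgroup.closure_induction with
    | mem g hg => exact hX g hg
    | one => simp
    | mul a b _ _ ha hb => intro x y; simp [ha, hb]
    | inv a _ ha => intro x y; simpa using (ha (a⁻¹ x) (a⁻¹ y)).symm
  obtain ⟨i, hik⟩ := exists_ne k
  obtain ⟨a, b, hab⟩ := exists_pair_ne A
  let x : ι → A := fun _ => a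
  let y : ι → A := Function.update x i b
  let z : ι → A := Function.update x k b
  have hyk : y k = x k := by simp [y, hik.symm]
  have hxy : x ≠ y := fun h => hab (by simpa [x, y] using congrFun h i)
  have hxz : x ≠ z := fun h => hab (by simpa [x, z] using congrFun h k)
  have h := (hall (Equiv.swap y z) x y).mpr hyk.symm
  rw [Equiv.swap_apply_of_ne_of_ne hxy hxz, Equiv.swap_apply_left] at h
  exact hab (by simpa [x, z] using h)

/-- A set of `n` instructions generating `Sym(A^n)` contains no unary
instruction. -/
theorem no_unary_in_minimum_generating_set
    (q n : ℕ) (A : Type*) [Fintype A] [DecidableEq A]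
    (hA : Fintype.card A = q) (hq : 2 ≤ q) (hn : 2 ≤ n)
    (X : Finset (Equiv.Perm (Fin n → A)))
    (hcard : X.card = n) (hinstr : ∀ g ∈ X, IsInstruction g)
    (hgen : Subgroup.closure (X : Set (Equiv.Perm (Fin n → A))) = ⊤) :
    ∀ g ∈ X, ¬ IsUnaryInstruction g := by
  classical
  rintro g hg ⟨j, hgj, h, hh⟩
  have : Nontrivial A := Fintype.one_lt_card_iff_nontrivial.mp (by omega)
  have : Nontrivial (Fin n) := Fin.nontrivial_iff_two_le.mpr hn
  have hreg : ∀ u : X, ∃ k : Fin n, (u.1 = g → k = j) ∧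
      ∀ (x : Fin n → A) (i : Fin n), i ≠ k → u.1 x i = x i := by
    rintro ⟨u, hu⟩
    by_cases hug : u = g
    · exact ⟨j, fun _ => rfl, hug ▸ hgj⟩
    · obtain ⟨k, hk⟩ := hinstr u hu
      exact ⟨k, fun e => absurd e hug, hk⟩
  choose f hfg hf using hreg
  have hsurj : Function.Surjective f := by
    intro k
    by_contra! hk
    refine closure_ne_top_of_coordinate_congruence k (fun u hu x y => ?_) hgen
    rw [hf ⟨u, hu⟩ x k (hk _).symm, hf ⟨u, hu⟩ y k (hk _).symm]
  have hinj : Function.Injective f :=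
    ((Fintype.bijective_iff_surjective_and_card f).mpr ⟨hsurj, by simp [hcard]⟩).1
  refine closure_ne_top_of_coordinate_congruence j (fun u hu x y => ?_) hgen
  by_cases hug : u = g
  · rw [hug, hh, hh, h.injective.eq_iff]
  · have hne : j ≠ f ⟨u, hu⟩ := fun e =>
      hug (congrArg Subtype.val (hinj (e.symm.trans (hfg ⟨g, hg⟩ rfl).symm)))
    rw [hf ⟨u, hu⟩ x j hne, hf ⟨u, hu⟩ y j hne]
end

section
/- For all q ≥ 2 and n ≥ 2, the set of all instructions on A^n generates the full symmetric group Sym(A^n). -/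
theorem isInstruction_swap_update {n : ℕ} {A : Type*} [DecidableEq A]
    (x : Fin n → A) (j : Fin n) (a : A) :
    IsInstruction (Equiv.swap x (Function.update x j a)) := by
  refine ⟨j, fun z i hi => ?_⟩
  rw [Equiv.swap_apply_def]
  split_ifs with h₁ h₂
  · rw [h₁, Function.update_of_ne hi]
  · rw [h₂, Function.update_of_ne hi]
  · rfl

theorem swap_mem_closure_isInstruction {n : ℕ} {A : Type*} [DecidableEq A]
    (x y : Fin n → A) :
    Equiv.swap x y ∈ Subgroup.closure {g : Equiv.Perm (Fin n → A) | IsInstruction g} := by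
  suffices h : ∀ s : Finset (Fin n), Equiv.swap x (s.piecewise y x) ∈
      Subgroup.closure {g : Equiv.Perm (Fin n → A) | IsInstruction g} by
    simpa using h Finset.univ
  intro s
  induction s using Finset.induction_on with
  | empty =>
    rw [Finset.piecewise_empty, Equiv.swap_self]
    exact one_mem _
  | insert j s _ ih =>
    rw [Finset.piecewise_insert]
    exact SubmonoidClass.swap_mem_trans _ ih
      (Subgroup.subset_closure (isInstruction_swap_update _ j (y j)))

/-- The set of all instructions generates the symmetric group `Sym(A^n)`. -/
theorem instructions_generate_symmetric
    (q n : ℕ) (A : Type*) [Fintype A] [DecidableEq A]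
    (hA : Fintype.card A = q) (hq : 2 ≤ q) (hn : 2 ≤ n) :
    Subgroup.closure {g : Equiv.Perm (Fin n → A) | IsInstruction g} = ⊤ := by
  rw [eq_top_iff, ← Equiv.Perm.closure_isSwap, Subgroup.closure_le]
  rintro _ ⟨x, y, _, rfl⟩
  exact swap_mem_closure_isInstruction x y
end

section
/- Let A = GF(2) and n ≥ 2. The subgroup of Sym(A^n) generated by all binary (2-ary) instructions is exactly the affine group Aff(n,2), i.e. the group of all permutations of A^n of the form x ↦ Mx + b where M is an invertible n×n matrix over GF(2) and b ∈ GF(2)^n. -/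
/-- An *`l`-ary instruction* on `A^n` is a permutation of `Fin n → A` which
changes at most one coordinate `j`, the new value of that coordinate
depending on at most `l` of the registers. -/
def IsLAryInstruction {n : ℕ} {A : Type*} (l : ℕ)
    (g : Equiv.Perm (Fin n → A)) : Prop :=
  ∃ j : Fin n, (∀ (x : Fin n → A) (i : Fin n), i ≠ j → g x i = x i) ∧
    ∃ S : Finset (Fin n), S.card ≤ l ∧
      ∀ x y : Fin n → A, (∀ i ∈ S, x i = y i) → g x j = g y j

theorem ZMod.two_map_add_add_of_ne (u : ZMod 2 → ZMod 2 → ZMod 2)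
    (hu : ∀ b, u 0 b ≠ u 1 b) (a a' a'' b b' b'' : ZMod 2) :
    u (a + a' + a'') (b + b' + b'') = u a b + u a' b' + u a'' b'' := by
  revert u hu a a' a'' b b' b''
  decide

/-- The register updated by an `l`-ary instruction on at least two symbols is one of the
registers read by it. -/
theorem mem_of_update_depends_on {n : ℕ} {A : Type*} [Nontrivial A]
    (g : Equiv.Perm (Fin n → A)) (j : Fin n)
    (hg : ∀ (x : Fin n → A) (i : Fin n), i ≠ j → g x i = x i) (S : Finset (Fin n))
    (hS : ∀ x y : Fin n → A, (∀ i ∈ S, x i = y i) → g x j = g y j) : j ∈ S := by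
  by_contra hj
  obtain ⟨a, b, hab⟩ := exists_pair_ne A
  have hne : ∀ i, i ≠ j → Function.update (fun _ : Fin n => a) j b i = a := fun i hi => by
    simp [hi]
  have h : g (fun _ => a) = g (Function.update (fun _ => a) j b) := by
    funext i
    by_cases hi : i = j
    · subst hi
      exact hS _ _ fun k hk => (hne k (by rintro rfl; exact hj hk)).symm
    · rw [hg _ i hi, hg _ i hi, hne i hi]
  have := congrFun (g.injective h) j
  simp [hab] at this

theorem IsLAryInstruction.map_add_add {n : ℕ} {g : Equiv.Perm (Fin n → ZMod 2)}
    (h : IsLAryInstruction 2 g) (x y z : Fin n → ZMod 2) :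
    g (x + y + z) = g x + g y + g z := by
  obtain ⟨j, hg, S, hcard, hS⟩ := h
  have hj := mem_of_update_depends_on g j hg S hS
  obtain ⟨k, hk⟩ : ∃ k, ∀ i ∈ S, i ≠ j → i = k := by
    have hle : (S.erase j).card ≤ 1 := by
      rw [Finset.card_erase_of_mem hj]
      omega
    have : Nonempty (Fin n) := ⟨j⟩
    obtain ⟨k, hk⟩ := Finset.card_le_one_iff_subset_singleton.1 hle
    exact ⟨k, fun i hi hij => Finset.mem_singleton.1 (hk (Finset.mem_erase.2 ⟨hij, hi⟩))⟩
  let u : ZMod 2 → ZMod 2 → ZMod 2 := fun a b => g (fun i => if i = j then a else b) j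
  have hgu : ∀ w, g w j = u (w j) (w k) := fun w => by
    refine hS _ _ fun i hi => ?_
    by_cases hij : i = j
    · simp [hij]
    · obtain rfl := hk i hi hij
      simp [hij]
  have hne : ∀ b, u 0 b ≠ u 1 b := fun b hb => by
    have h : g (fun i => if i = j then 0 else b) = g (fun i => if i = j then 1 else b) := by
      funext i
      by_cases hi : i = j
      · subst hi
        exact hb
      · simp [hg _ i hi, hi]
    simpa using congrFun (g.injective h) j
  funext i
  by_cases hi : i = j
  · subst hi
    simp only [Pi.add_apply, hgu]
    exact ZMod.two_map_add_add_of_ne u hne _ _ _ _ _ _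
  · simp [hg _ i hi]

theorem map_add_add_of_mem_closure {n : ℕ} {f : Equiv.Perm (Fin n → ZMod 2)}
    (hf : f ∈ Subgroup.closure {g : Equiv.Perm (Fin n → ZMod 2) | IsLAryInstruction 2 g})
    (x y z : Fin n → ZMod 2) : f (x + y + z) = f x + f y + f z := by
  induction hf using Subgroup.closure_induction generalizing x y z with
  | mem g hg => exact hg.map_add_add x y z
  | one => rfl
  | mul f g _ _ ihf ihg => simp [ihf, ihg]
  | inv f _ ih =>
    apply f.injective
    simp [ih]

theorem ZMod.pi_two_add_self {ι : Type*} (v : ι → ZMod 2) : v + v = 0 :=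
  funext fun i => CharTwo.add_self_eq_zero (v i)

theorem exists_mulVec_add_of_map_add_add {n : ℕ} (f : Equiv.Perm (Fin n → ZMod 2))
    (hf : ∀ x y z, f (x + y + z) = f x + f y + f z) :
    ∃ (M : Matrix (Fin n) (Fin n) (ZMod 2)) (b : Fin n → ZMod 2),
      IsUnit M ∧ ∀ x : Fin n → ZMod 2, f x = M.mulVec x + b := by
  let φ : (Fin n → ZMod 2) →+ (Fin n → ZMod 2) :=
    { toFun := fun x => f x + f 0
      map_zero' := ZMod.pi_two_add_self _
      map_add' := fun x y => by
        have := hf x y 0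
        rw [add_zero] at this
        rw [this, add_add_add_comm, add_assoc (f x + f y)] }
  let L : (Fin n → ZMod 2) →ₗ[ZMod 2] (Fin n → ZMod 2) := φ.toZModLinearMap 2
  have hL : ∀ x, (LinearMap.toMatrix' L).mulVec x = f x + f 0 := fun x =>
    LinearMap.toMatrix'_mulVec L x
  refine ⟨LinearMap.toMatrix' L, f 0, ?_, fun x => ?_⟩
  · rw [← Matrix.mulVec_injective_iff_isUnit]
    intro x y hxy
    rw [hL, hL] at hxy
    exact f.injective (add_right_cancel hxy)
  · rw [hL, add_assoc, ZMod.pi_two_add_self, add_zero]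

/-- Adding `c * x k + d` to register `j`, where `k ≠ j`, is a binary instruction. -/
theorem exists_instruction_add_single {n : ℕ} {j k : Fin n} (hjk : j ≠ k) (c d : ZMod 2) :
    ∃ g ∈ Subgroup.closure {g : Equiv.Perm (Fin n → ZMod 2) | IsLAryInstruction 2 g},
      ∀ x, g x = x + Pi.single j (c * x k + d) := by
  have hinv : Function.Involutive
      (fun x : Fin n → ZMod 2 => x + Pi.single j (c * x k + d)) := fun x => by
    simp [hjk.symm, add_assoc, ZMod.pi_two_add_self]
  refine ⟨hinv.toPerm, Subgroup.subset_closure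
    ⟨j, fun x i hi => by simp [hi], {j, k}, Finset.card_le_two, fun x y hxy => ?_⟩, fun x => rfl⟩
  have hj : x j = y j := hxy j (by simp)
  have hk : x k = y k := hxy k (by simp)
  simp [hj, hk]

theorem exists_mem_closure_mulVec {n : ℕ} (M : Matrix (Fin n) (Fin n) (ZMod 2))
    (hM : M.det ≠ 0) :
    ∃ g ∈ Subgroup.closure {g : Equiv.Perm (Fin n → ZMod 2) | IsLAryInstruction 2 g},
      ∀ x, g x = M.mulVec x := by
  refine Matrix.diagonal_transvection_induction_of_det_ne_zero (fun M => ∃ g ∈ Subgroup.closure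
    {g : Equiv.Perm (Fin n → ZMod 2) | IsLAryInstruction 2 g}, ∀ x, g x = M.mulVec x)
    M hM (fun D hD => ?_) (fun t => ?_) ?_
  · have h : D = 1 := by
      funext i
      rw [Matrix.det_diagonal, Finset.prod_ne_zero_iff] at hD
      exact (by decide : ∀ a : ZMod 2, a ≠ 0 → a = 1) _ (hD i (Finset.mem_univ i))
    exact ⟨1, one_mem _, fun x => by simp [h]⟩
  · obtain ⟨g, hg, h⟩ := exists_instruction_add_single t.hij t.c 0
    refine ⟨g, hg, fun x => ?_⟩
    rw [h, Matrix.TransvectionStruct.toMatrix, Matrix.transvection, Matrix.add_mulVec,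
      Matrix.one_mulVec, Matrix.single_mulVec, add_zero]
    rfl
  · rintro A B _ _ ⟨f, hf, hfA⟩ ⟨g, hg, hgB⟩
    exact ⟨f * g, mul_mem hf hg, fun x => by simp [hfA, hgB]⟩

theorem exists_mem_closure_add {n : ℕ} (hn : 2 ≤ n) (b : Fin n → ZMod 2) :
    ∃ g ∈ Subgroup.closure {g : Equiv.Perm (Fin n → ZMod 2) | IsLAryInstruction 2 g},
      ∀ x, g x = x + b := by
  rw [← Finset.univ_sum_single b]
  refine Finset.sum_induction _ (fun b => ∃ g ∈ Subgroup.closure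
    {g : Equiv.Perm (Fin n → ZMod 2) | IsLAryInstruction 2 g}, ∀ x, g x = x + b) ?_ ?_ ?_
  · rintro b c ⟨f, hf, hfb⟩ ⟨g, hg, hgc⟩
    exact ⟨g * f, mul_mem hg hf, fun x => by simp [hfb, hgc, add_assoc]⟩
  · exact ⟨1, one_mem _, fun x => by simp⟩
  · intro j _
    have : Nontrivial (Fin n) := Fin.nontrivial_iff_two_le.2 hn
    obtain ⟨k, hk⟩ := exists_ne j
    simpa using exists_instruction_add_single hk.symm 0 (b j)

/-- Over `GF(2)`, the binary instructions generate exactly the affine group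
`Aff(n, 2)`, i.e. the permutations `x ↦ M x + b` with `M` invertible. -/
theorem binary_instructions_generate_affine (n : ℕ) (hn : 2 ≤ n) :
    (Subgroup.closure
        {g : Equiv.Perm (Fin n → ZMod 2) | IsLAryInstruction 2 g} :
      Set (Equiv.Perm (Fin n → ZMod 2))) =
    {f : Equiv.Perm (Fin n → ZMod 2) |
      ∃ (M : Matrix (Fin n) (Fin n) (ZMod 2)) (b : Fin n → ZMod 2),
        IsUnit M ∧ ∀ x : Fin n → ZMod 2, f x = M.mulVec x + b} := by
  ext f
  constructor
  · exact fun hf => exists_mulVec_add_of_map_add_add f (map_add_add_of_mem_closure hf)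
  · rintro ⟨M, b, hM, hf⟩
    obtain ⟨g, hg, hgM⟩ :=
      exists_mem_closure_mulVec M ((Matrix.isUnit_iff_isUnit_det M).1 hM).ne_zero
    obtain ⟨t, ht, htb⟩ := exists_mem_closure_add hn b
    have h : f = t * g := by
      ext1 x
      simp [hf, hgM, htb]
    rw [h]
    exact mul_mem ht hg
end
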